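/- arXiv:2207.01877 — 11 statements merged into one kernel-verified Lean document; each statement's English description precedes it below -/
import Mathlib

section
/- Let q ≥ 5 be an odd prime power, let n = (q−1)/2, let β be a primitive (q−1)-th root of unity in GF(q), and let 2 ≤ δ ≤ n be an integer. Set g(x) = ∏_{i=0}^{δ−2} (x − β^{1+2i}) ∈ GF(q)[x]. Then g(x) divides x^n + 1, the negacyclic code of length n over GF(q) with generator polynomial g(x) has dimension n − (δ−1), and its minimum distance equals δ; in particular this code is MDS. -/
open Polynomial

/-- The negacyclic code of length `n` over `F` with generator polynomial `g`
(the set of `c ∈ F[X]` with `deg c < n` and `g ∣ c`) has minimum Hamming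
distance exactly `d`. -/
def IsMinDist {F : Type*} [Field F] (g : Polynomial F) (n d : ℕ) : Prop :=
  (∃ c : Polynomial F, c ≠ 0 ∧ g ∣ c ∧ c.natDegree < n ∧ c.support.card = d) ∧
  ∀ c : Polynomial F, c ≠ 0 → g ∣ c → c.natDegree < n → d ≤ c.support.card

/-- The BCH bound: if a nonzero polynomial `c` of degree less than `n` vanishes at
`β * γ ^ i` for all `i < m`, where `γ` is a primitive `n`-th root of unity, then `c`
has more than `m` nonzero coefficients. -/
theorem lt_card_support_of_eval_eq_zero {F : Type*} [Field F] {n m : ℕ} {β γ : F}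
    (hβ : β ≠ 0) (hγ : IsPrimitiveRoot γ n) {c : F[X]} (hc : c ≠ 0) (hdeg : c.natDegree < n)
    (heval : ∀ i < m, c.eval (β * γ ^ i) = 0) : m < c.support.card := by
  by_contra! hle
  let e := c.support.equivFin.symm
  have hmem (j : Fin c.support.card) : (e j : ℕ) < n :=
    (le_natDegree_of_mem_supp _ (e j).2).trans_lt hdeg
  have hinj : Function.Injective fun j => γ ^ (e j : ℕ) := fun a b hab =>
    e.injective (Subtype.ext (hγ.pow_inj (hmem a) (hmem b) hab))
  have hv : (fun j => c.coeff (e j) * β ^ (e j : ℕ)) = 0 := by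
    refine Matrix.eq_zero_of_forall_pow_sum_mul_pow_eq_zero hinj fun i => ?_
    have h := heval i (i.2.trans_le hle)
    rw [eval_eq_sum, Polynomial.sum, ← Finset.sum_coe_sort, ← e.sum_comp] at h
    rw [← h]
    refine Finset.sum_congr rfl fun j _ => ?_
    rw [mul_pow, ← pow_mul, ← pow_mul, mul_comm (i : ℕ)]
    ring
  obtain ⟨a, ha⟩ := nonempty_support_iff.mpr hc
  have h := congrFun hv (e.symm ⟨a, ha⟩)
  simp only [Equiv.apply_symm_apply, Pi.zero_apply] at h
  exact mul_ne_zero (mem_support_iff.mp ha) (pow_ne_zero _ hβ) h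

theorem stmt1 (q : ℕ) (hq : Odd q) (hpp : IsPrimePow q) (hq5 : 5 ≤ q)
    (F : Type) [Field F] [Fintype F] (hF : Fintype.card F = q)
    (n : ℕ) (hn : n = (q - 1) / 2)
    (β : F) (hβ : IsPrimitiveRoot β (q - 1))
    (δ : ℕ) (hδ2 : 2 ≤ δ) (hδn : δ ≤ n)
    (g : Polynomial F)
    (hg : g = ∏ i ∈ Finset.range (δ - 1), (X - C (β ^ (1 + 2 * i)))) :
    g ∣ (X ^ n + 1 : Polynomial F) ∧
    g.natDegree = δ - 1 ∧
    IsMinDist g n δ ∧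
    δ = n - (n - (δ - 1)) + 1 := by
  have hqn : q - 1 = n * 2 := by obtain ⟨k, rfl⟩ := hq; omega
  have hpos : 0 < q - 1 := by omega
  have hβ0 : β ≠ 0 := hβ.ne_zero hpos.ne'
  have hγ : IsPrimitiveRoot (β ^ 2) n := hβ.pow hpos (by rw [hqn, mul_comm])
  have hβn : β ^ n = -1 := by
    have h : β ^ n * β ^ n = 1 := by rw [← pow_add, ← mul_two, ← hqn, hβ.pow_eq_one]
    exact (mul_self_eq_one_iff.mp h).resolve_left (hβ.pow_ne_one_of_pos_of_lt (by omega) (by omega))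
  have hdeg : g.natDegree = δ - 1 := by
    rw [hg, natDegree_prod_of_monic _ _ fun i _ => monic_X_sub_C _]
    simp only [natDegree_X_sub_C, Finset.sum_const, Finset.card_range, smul_eq_mul, mul_one]
  have hg0 : g ≠ 0 := by
    rw [hg]
    exact (monic_prod_of_monic _ _ fun i _ => monic_X_sub_C _).ne_zero
  have hbound (c : F[X]) (hc : c ≠ 0) (hgc : g ∣ c) (hcn : c.natDegree < n) :
      δ ≤ c.support.card := by
    have := lt_card_support_of_eval_eq_zero (m := δ - 1) hβ0 hγ hc hcn fun i hi => by
      rw [← pow_mul, ← pow_succ', add_comm, ← IsRoot.def, ← dvd_iff_isRoot]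
      refine dvd_trans ?_ hgc
      rw [hg]
      exact Finset.dvd_prod_of_mem (fun i => X - C (β ^ (1 + 2 * i))) (Finset.mem_range.mpr hi)
    omega
  refine ⟨?_, hdeg, ⟨⟨g, hg0, dvd_rfl, by omega, ?_⟩, hbound⟩, by omega⟩
  · rw [hg]
    refine Finset.prod_dvd_of_coprime (fun i hi j hj hij => ?_) fun i _ => ?_
    · simp only [Finset.coe_range, Set.mem_Iio] at hi hj
      refine isCoprime_X_sub_C_of_isUnit_sub (sub_ne_zero.mpr fun h => hij ?_).isUnit
      have := hβ.pow_inj (by omega) (by omega) h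
      omega
    · rw [dvd_iff_isRoot, IsRoot.def, eval_add, eval_pow, eval_X, eval_one, ← pow_mul, mul_comm,
        pow_mul, hβn, Odd.neg_one_pow ⟨i, add_comm _ _⟩, neg_add_cancel]
  · have h := card_supp_le_succ_natDegree g
    exact le_antisymm (by omega) (hbound g hg0 dvd_rfl (by omega))
end

section
/- Let q be an odd prime power, let n = (q+1)/2, let β be a primitive (q+1)-th root of unity in GF(q^2), and let 2 ≤ δ ≤ ⌊(q+3)/4⌋ be an integer. Let g(x) = lcm(M_{β^1}(x), M_{β^3}(x), ..., M_{β^{1+2(δ−2)}}(x)), where M_{β^s}(x) denotes the minimal polynomial of β^s over GF(q). Then the negacyclic code of length n over GF(q) with generator polynomial g(x) has dimension n − 2(δ−1) and minimum distance 2δ − 1; in particular this code is MDS. -/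
open Polynomial

/-- The BCH bound: a nonzero polynomial of degree less than the order of `b` that vanishes at
`γ, γ b, …, γ b ^ (N - 1)` has more than `N` nonzero coefficients. -/
theorem lt_card_support_of_consecutive_roots {F E : Type*} [Field F] [Field E] [Algebra F E]
    {n N : ℕ} {b γ : E} (hb : IsPrimitiveRoot b n) (hγ : γ ≠ 0) {c : F[X]} (hc : c ≠ 0)
    (hdeg : c.natDegree < n) (hroot : ∀ j < N, aeval (γ * b ^ j) c = 0) :
    N < c.support.card := by
  by_contra! hle
  let e := c.support.equivFin.symm
  have hinj : Function.Injective (fun i => b ^ (e i : ℕ)) := by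
    intro i k hik
    have hlt (m) : (e m : ℕ) < n :=
      (le_natDegree_of_mem_supp _ (e m).2).trans_lt hdeg
    exact e.injective (Subtype.ext (hb.pow_inj (hlt i) (hlt k) hik))
  have hzero := Matrix.eq_zero_of_forall_pow_sum_mul_pow_eq_zero
    (v := fun i => algebraMap F E (c.coeff (e i)) * γ ^ (e i : ℕ)) hinj (by
      intro j
      have h := hroot j (j.2.trans_le hle)
      rw [aeval_def, eval₂_eq_sum, Polynomial.sum,
        ← Finset.sum_coe_sort, ← e.sum_comp] at h
      rw [← h]
      refine Finset.sum_congr rfl fun i _ => ?_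
      ring)
  obtain ⟨s, hs⟩ := nonempty_support_iff.2 hc
  have h := congrFun hzero (e.symm ⟨s, hs⟩)
  simp only [Equiv.apply_symm_apply, Pi.zero_apply, mul_eq_zero, pow_eq_zero_iff', hγ,
    map_eq_zero, false_and, or_false] at h
  exact mem_support_iff.1 hs h

/-- If `α ^ (q + 1) = 1` with `q` the order of `F`, then the zeros of a polynomial over `F`
include `α⁻¹` together with `α`. -/
theorem aeval_inv_eq_zero_of_pow_card_add_one {F E : Type*} [Field F] [Fintype F] [Field E]
    [Algebra F E] {α : E} (hα : α ^ (Fintype.card F + 1) = 1) {p : F[X]}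
    (hp : aeval α p = 0) : aeval α⁻¹ p = 0 := by
  have h : α⁻¹ = FiniteField.frobeniusAlgHom F E α := by
    rw [FiniteField.coe_frobeniusAlgHom]
    exact inv_eq_of_mul_eq_one_right (by rw [← pow_succ', hα])
  rw [h, aeval_algHom_apply, hp, map_zero]

theorem stmt2 (q : ℕ) (hq : Odd q) (hpp : IsPrimePow q)
    (F E : Type) [Field F] [Fintype F] [DecidableEq F] [Field E] [Fintype E] [Algebra F E]
    (hF : Fintype.card F = q) (hE : Fintype.card E = q ^ 2)
    (n : ℕ) (hn : n = (q + 1) / 2)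
    (β : E) (hβ : IsPrimitiveRoot β (q + 1))
    (δ : ℕ) (hδ2 : 2 ≤ δ) (hδ : δ ≤ (q + 3) / 4)
    (g : Polynomial F)
    (hg : g = Finset.lcm (Finset.range (δ - 1)) (fun i => minpoly F (β ^ (1 + 2 * i)))) :
    g.natDegree = 2 * (δ - 1) ∧
    IsMinDist g n (2 * δ - 1) ∧
    2 * δ - 1 = n - (n - 2 * (δ - 1)) + 1 := by
  have hfin : Module.finrank F E = 2 := by
    have h := Module.card_eq_pow_finrank (K := F) (V := E)
    rw [hF, hE] at h
    exact (Nat.pow_right_injective hpp.two_le h).symm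
  have : FiniteDimensional F E := Module.finite_of_finrank_pos (by omega)
  have hqn : q + 1 = 2 * n := by obtain ⟨k, rfl⟩ := hq; omega
  have hβ0 : β ≠ 0 := hβ.ne_zero (by omega)
  have hb : IsPrimitiveRoot (β ^ 2) n := hβ.pow (by omega) hqn
  have hroot {c : F[X]} (hgc : g ∣ c) : ∀ j < 2 * (δ - 1),
      aeval ((β⁻¹) ^ (2 * δ - 3) * (β ^ 2) ^ j) c = 0 := by
    intro j hj
    have hpos (i : ℕ) (hi : i < δ - 1) : aeval (β ^ (1 + 2 * i)) c = 0 := by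
      refine (minpoly.dvd_iff).1 (dvd_trans ?_ hgc)
      rw [hg]
      exact Finset.dvd_lcm (f := fun i => minpoly F (β ^ (1 + 2 * i))) (Finset.mem_range.2 hi)
    rw [← pow_mul]
    rcases lt_or_ge j (δ - 1) with h | h
    · have hinv := aeval_inv_eq_zero_of_pow_card_add_one (F := F)
        (by rw [hF, ← pow_mul, mul_comm, pow_mul, hβ.pow_eq_one, one_pow])
        (hpos (δ - 2 - j) (by omega))
      have hexp : 2 * δ - 3 = 1 + 2 * (δ - 2 - j) + 2 * j := by omega
      rwa [hexp, pow_add, mul_assoc, ← mul_pow, inv_mul_cancel₀ hβ0, one_pow, mul_one, inv_pow]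
    · have hexp : 2 * j = 2 * δ - 3 + (1 + 2 * (j - (δ - 1))) := by omega
      rw [hexp, pow_add, ← mul_assoc, ← mul_pow, inv_mul_cancel₀ hβ0, one_pow, one_mul]
      exact hpos _ (by omega)
  have hprod : (∏ i ∈ Finset.range (δ - 1), minpoly F (β ^ (1 + 2 * i))) ≠ 0 :=
    Finset.prod_ne_zero_iff.2 fun i _ => minpoly.ne_zero (.of_finite F _)
  have hgdvd : g ∣ ∏ i ∈ Finset.range (δ - 1), minpoly F (β ^ (1 + 2 * i)) := by
    rw [hg]
    exact Finset.lcm_dvd fun i hi => Finset.dvd_prod_of_mem _ hi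
  have hg0 : g ≠ 0 := ne_zero_of_dvd_ne_zero hprod hgdvd
  have hle : g.natDegree ≤ 2 * (δ - 1) := by
    refine (natDegree_le_of_dvd hgdvd hprod).trans ((natDegree_prod_le _ _).trans ?_)
    refine (Finset.sum_le_card_nsmul _ _ 2 fun i _ => ?_).trans (by simp [mul_comm])
    exact hfin ▸ minpoly.natDegree_le _
  have hbch (c : F[X]) (hc : c ≠ 0) (hgc : g ∣ c) (hd : c.natDegree < n) :
      2 * δ - 1 ≤ c.support.card := by
    have := lt_card_support_of_consecutive_roots hb (pow_ne_zero _ (inv_ne_zero hβ0)) hc hd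
      (hroot hgc)
    omega
  have hdn : g.natDegree < n := by omega
  have hsupp := card_supp_le_succ_natDegree g
  have hweight := hbch g hg0 dvd_rfl hdn
  exact ⟨by omega, ⟨⟨g, hg0, dvd_rfl, hdn, by omega⟩, hbch⟩, by omega⟩
end

section
/- Let q be an odd prime power, m ≥ 2, n = (q^m−1)/2, and let β be a primitive (q^m−1)-th root of unity in GF(q^m). Let δ be an integer with 2 ≤ δ ≤ q^{m/2}+1 if m is even and 2 ≤ δ ≤ (q^{(m+1)/2}+1)/2 if m is odd. Then the negacyclic BCH code C_{(q,n,δ,0)} has generator polynomial g(x) = ∏ M_{β^{1+2i}}(x), the product over those i with 0 ≤ i ≤ δ−2 and i ≢ (q−1)/2 (mod q); its dimension is n − m·⌈(2δ−3)(q−1)/(2q)⌉; and its minimum distance d satisfies d ≥ δ+1 if δ ≡ (q+1)/2 (mod q) and d ≥ δ otherwise. -/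
open Polynomial

/-- Every nonzero codeword of the negacyclic code of length `n` over `F` with
generator polynomial `g` has Hamming weight at least `d` (i.e. the minimum
distance is at least `d`). -/
def MinDistLB {F : Type*} [Field F] (g : Polynomial F) (n d : ℕ) : Prop :=
  ∀ c : Polynomial F, c ≠ 0 → g ∣ c → c.natDegree < n → d ≤ c.support.card

lemma mul_pow_not_modEq_of_even {q h j s t : ℕ} (hq3 : 3 ≤ q) (hj0 : 0 < j) (hjh : j ≤ h)
    (hs : s ≤ 2 * q ^ h - 1) (ht : t ≤ 2 * q ^ h - 1) (hqo : Odd q) (hso : Odd s)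
    (hqs : ¬ q ∣ s) (hqt : ¬ q ∣ t) : ¬ s * q ^ j ≡ t [MOD q ^ (2 * h) - 1] := by
  intro H
  obtain ⟨k, rfl⟩ : ∃ k, h = k + 1 := ⟨h - 1, by omega⟩
  have hQ : 1 ≤ q ^ k := Nat.one_le_pow _ _ (by omega)
  have hR : q ^ (k + 1) = q * q ^ k := by ring
  have hM : q ^ (2 * (k + 1)) = q ^ (k + 1) * q ^ (k + 1) := by ring
  have hqj : ∀ a, q ∣ a * q ^ j := fun a => Dvd.dvd.mul_left (dvd_pow_self q (by omega)) a
  have hqR : q ∣ q ^ (k + 1) := dvd_pow_self q (by omega)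
  have hRo : Odd (q ^ (k + 1)) := hqo.pow
  set R := q ^ (k + 1) with hRdef
  set M := q ^ (2 * (k + 1)) with hMdef
  have hR3 : 3 ≤ R := by rw [hR]; nlinarith
  have hMR : 3 * R ≤ M := by rw [hM]; nlinarith
  have htM : t < M - 1 := by omega
  have small : s * q ^ j < M - 1 → False := fun hlt =>
    hqt (by rw [← H.eq_of_lt_of_lt hlt htM]; exact hqj s)
  rcases Nat.lt_or_ge j (k + 1) with hj | hj
  · apply small
    have h1 : q ^ j ≤ q ^ k := Nat.pow_le_pow_right (by omega) (by omega)
    have h2 : s * q ^ j ≤ (2 * R - 1) * q ^ k := Nat.mul_le_mul hs h1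
    have h3 : (2 * R - 1) * q ^ k + q ^ k = 2 * R * q ^ k := by
      rw [← Nat.succ_mul]; congr 1; omega
    have h4 : 3 * (R * q ^ k) ≤ M := by rw [hM, hR]; nlinarith [Nat.zero_le (q * q ^ k * q ^ k)]
    have h5 : 3 ≤ R * q ^ k := by nlinarith
    have h6 : 2 * R * q ^ k = 2 * (R * q ^ k) := by ring
    omega
  · obtain rfl : j = k + 1 := by omega
    rw [← hRdef] at H small hqj
    rcases Nat.lt_or_ge s R with hsR | hsR
    · apply small
      have : s * R + R ≤ M := by rw [hM]; nlinarith
      omega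
    · obtain ⟨r, rfl⟩ := Nat.exists_eq_add_of_le hsR
      have h1 : (R + r) * R ≡ 1 + r * R [MOD M - 1] := by
        have : (R + r) * R = (M - 1) + (1 + r * R) := by
          rw [add_mul, ← hM]; omega
        rw [this]
        exact Nat.add_modEq_left
      have h2 : r * R + R ≤ M := by rw [hM]; nlinarith [show r + 1 ≤ R by omega]
      have h3 := (h1.symm.trans H).eq_of_lt_of_lt (by omega) htM
      have h4 : r < 2 := by
        by_contra hr
        have : 2 * R ≤ r * R := Nat.mul_le_mul_right _ (by omega)
        omega
      have h5 : r = 0 := by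
        have := Nat.odd_add.mp hso |>.mp hRo
        interval_cases r
        · rfl
        · simp at this
      subst h5
      exact hqs (by simpa using hqR)

lemma mul_pow_not_modEq_of_odd {q h j s t : ℕ} (hq3 : 3 ≤ q) (hj0 : 0 < j) (hjh : j ≤ h)
    (hs : s + 2 ≤ q ^ (h + 1)) (ht : t + 2 ≤ q ^ (h + 1))
    (hqt : ¬ q ∣ t) : ¬ s * q ^ j ≡ t [MOD q ^ (2 * h + 1) - 1] := by
  intro H
  have hQ : 1 ≤ q ^ h := Nat.one_le_pow _ _ (by omega)
  have hM : q ^ (2 * h + 1) = q ^ (h + 1) * q ^ h := by ring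
  have h0 : q ^ (h + 1) ≤ q ^ (2 * h + 1) := Nat.pow_le_pow_right (by omega) (by omega)
  have h1 : q ^ j ≤ q ^ h := Nat.pow_le_pow_right (by omega) (by omega)
  have h2 : s * q ^ j ≤ s * q ^ h := Nat.mul_le_mul_left _ h1
  have h3 : (s + 2) * q ^ h ≤ q ^ (2 * h + 1) := by rw [hM]; exact Nat.mul_le_mul_right _ hs
  rw [add_mul] at h3
  apply hqt
  rw [← H.eq_of_lt_of_lt (by omega) (by omega)]
  exact Dvd.dvd.mul_left (dvd_pow_self q (by omega)) s

lemma mul_pow_not_modEq {q m δ j s t : ℕ} (hq3 : 3 ≤ q) (hqo : Odd q) (hδ2 : 2 ≤ δ)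
    (hδe : Even m → δ ≤ q ^ (m / 2) + 1) (hδo : Odd m → δ ≤ (q ^ ((m + 1) / 2) + 1) / 2)
    (hj0 : 0 < j) (hjm : j < m) (hs : s ≤ 2 * δ - 3) (ht : t ≤ 2 * δ - 3)
    (hso : Odd s) (hto : Odd t) (hqs : ¬ q ∣ s) (hqt : ¬ q ∣ t) :
    ¬ s * q ^ j ≡ t [MOD q ^ m - 1] := by
  wlog hj : j ≤ m / 2 generalizing j s t
  · intro H
    refine this (j := m - j) (by omega) (by omega) ht hs hto hso hqt hqs (by omega) ?_
    have h1 := H.symm.mul_right (q ^ (m - j))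
    rw [mul_assoc, ← pow_add, Nat.add_sub_cancel' hjm.le] at h1
    have h2 : q ^ m ≡ 1 [MOD q ^ m - 1] :=
      ((Nat.modEq_iff_dvd' (Nat.one_le_pow _ _ (by omega))).mpr dvd_rfl).symm
    simpa using h1.trans (h2.mul_left s)
  rcases Nat.even_or_odd' m with ⟨h, rfl | rfl⟩
  · have := hδe (by simp)
    rw [Nat.mul_div_cancel_left _ two_pos] at this hj
    exact mul_pow_not_modEq_of_even hq3 hj0 hj (by omega) (by omega) hqo hso hqs hqt
  · have := hδo (by simp)
    rw [show (2 * h + 1 + 1) / 2 = h + 1 by omega] at this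
    exact mul_pow_not_modEq_of_odd hq3 hj0 (by omega) (by omega) (by omega) hqt

lemma two_mul_sub_three_lt {q m δ : ℕ} (hq3 : 3 ≤ q) (hm : 2 ≤ m)
    (hδe : Even m → δ ≤ q ^ (m / 2) + 1) (hδo : Odd m → δ ≤ (q ^ ((m + 1) / 2) + 1) / 2) :
    2 * δ - 3 < q ^ m - 1 := by
  rcases Nat.even_or_odd' m with ⟨h, rfl | rfl⟩
  · have h1 := hδe (by simp)
    rw [Nat.mul_div_cancel_left _ two_pos] at h1
    have h2 : q ^ (2 * h) = q ^ h * q ^ h := by ring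
    have h3 : q ≤ q ^ h := Nat.le_self_pow (by omega) q
    have h4 : 3 * q ^ h ≤ q ^ h * q ^ h := Nat.mul_le_mul_right _ (by omega)
    omega
  · have h1 := hδo (by simp)
    rw [show (2 * h + 1 + 1) / 2 = h + 1 by omega] at h1
    have h2 : q ^ (h + 1) ≤ q ^ (2 * h + 1) := Nat.pow_le_pow_right (by omega) (by omega)
    have h3 : q ≤ q ^ (h + 1) := Nat.le_self_pow (by omega) q
    omega

lemma dvd_one_add_two_mul_iff {q : ℕ} (hq : Odd q) (i : ℕ) :
    q ∣ 1 + 2 * i ↔ i % q = (q - 1) / 2 := by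
  have hlt := Nat.mod_lt i hq.pos
  have hdvd : q ∣ 2 * (q * (i / q)) := ⟨2 * (i / q), by ring⟩
  have hi : 1 + 2 * i = 2 * (q * (i / q)) + (1 + 2 * (i % q)) := by
    have := Nat.div_add_mod i q
    omega
  rw [hi, Nat.dvd_add_right hdvd]
  obtain ⟨k, rfl⟩ := hq
  constructor
  · rintro ⟨c, hc⟩
    have h1 : c ≠ 0 := by rintro rfl; omega
    have h2 : c < 2 := by
      by_contra hc2
      have := Nat.mul_le_mul_left (2 * k + 1) (show 2 ≤ c by omega)
      omega
    obtain rfl : c = 1 := by omega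
    omega
  · intro h
    exact ⟨1, by omega⟩

lemma card_filter_range_mod_ne (q N : ℕ) (hq : Odd q) (hN : 1 ≤ N) :
    ((Finset.range N).filter (fun i => ¬ i % q = (q - 1) / 2)).card
      = ((2 * N - 1) * (q - 1) + (2 * q - 1)) / (2 * q) := by
  have hq0 : 0 < q := hq.pos
  obtain ⟨k, rfl⟩ := hq
  have key : ∀ N, ((Finset.range N).filter (fun i => ¬ i % (2 * k + 1) = k)).card
      + (N + k) / (2 * k + 1) = N := by
    intro N
    induction N with
    | zero => simp; omega
    | succ N ih =>
      rw [Finset.range_add_one, Finset.filter_insert, add_right_comm, Nat.succ_div]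
      have hiff : (2 * k + 1 ∣ N + k + 1) ↔ N % (2 * k + 1) = k := by
        have hc : Nat.Coprime (2 * k + 1) 2 := by simp
        rw [← hc.dvd_mul_right, show (N + k + 1) * 2 = 1 + 2 * N + (2 * k + 1) by ring,
          Nat.dvd_add_self_right, dvd_one_add_two_mul_iff ⟨k, rfl⟩]
        omega
      simp only [hiff]
      split_ifs with h
      · simp_all; omega
      · rw [Finset.card_insert_of_notMem (by simp)]; omega
  have h1 := key N
  have h2 := Nat.div_add_mod (N + k) (2 * k + 1)
  have h3 := Nat.mod_lt (N + k) hq0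
  set u := (N + k) / (2 * k + 1)
  set r := (N + k) % (2 * k + 1)
  rw [show (2 * k + 1 - 1) / 2 = k by omega]
  set a := ((Finset.range N).filter (fun i => ¬ i % (2 * k + 1) = k)).card
  obtain ⟨M, rfl⟩ : ∃ M, N = M + 1 := ⟨N - 1, by omega⟩
  rw [show 2 * (M + 1) - 1 = 2 * M + 1 by omega, show 2 * k + 1 - 1 = 2 * k by omega,
    show 2 * (2 * k + 1) - 1 = 4 * k + 1 by omega]
  symm
  rw [Nat.div_eq_iff (by omega)]
  have h4 : (2 * M + 1) * (2 * k) + (4 * k + 1) + 2 * r = a * (2 * (2 * k + 1)) + (4 * k + 1) := by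
    have h5 : (a + u : ℤ) = M + 1 := by exact_mod_cast h1
    zify at h2 ⊢
    linear_combination 2 * h2 - 2 * (2 * k + 1) * h5
  omega

/-- The BCH bound. -/
lemma lt_card_support_of_aeval_eq_zero {F E : Type*} [Field F] [Field E] [Algebra F E]
    {n k : ℕ} {b γ : E} (hb : b ≠ 0) (hγ : IsPrimitiveRoot γ n) {c : F[X]} (hc : c ≠ 0)
    (hcn : c.natDegree < n) (h : ∀ i < k, aeval (b * γ ^ i) c = 0) : k < c.support.card := by
  by_contra! hk
  let e := c.support.equivFin.symm
  have hv : (fun j => algebraMap F E (c.coeff (e j)) * b ^ (e j : ℕ)) = 0 := by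
    refine Matrix.eq_zero_of_forall_pow_sum_mul_pow_eq_zero (f := fun j => γ ^ (e j : ℕ)) ?_ ?_
    · intro x y hxy
      have hlt : ∀ z, (e z : ℕ) < n := fun z => (le_natDegree_of_mem_supp _ (e z).2).trans_lt hcn
      exact e.injective (Subtype.ext (hγ.pow_inj (hlt x) (hlt y) hxy))
    · intro i
      rw [← h i (i.2.trans_le hk), aeval_eq_sum_range, e.sum_comp (fun a : c.support =>
        algebraMap F E (c.coeff a) * b ^ (a : ℕ) * (γ ^ (a : ℕ)) ^ (i : ℕ)),
        Finset.sum_coe_sort c.support (fun a : ℕ =>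
        algebraMap F E (c.coeff a) * b ^ a * (γ ^ a) ^ (i : ℕ)), ← aeval_eq_sum_range,
        aeval_def, eval₂_eq_sum, Polynomial.sum]
      exact Finset.sum_congr rfl fun a _ => by ring
  have h0 : natDegree c ∈ c.support := natDegree_mem_support_of_nonzero hc
  have := congrFun hv (e.symm ⟨_, h0⟩)
  simp [hb, hc] at this

section FiniteField

variable {F E : Type*} [Field F] [Fintype F] [Field E] [Finite E] [Algebra F E]

lemma minpoly_pow_card (x : E) : minpoly F (x ^ Fintype.card F) = minpoly F x := by
  rw [← minpoly.algEquiv_eq (FiniteField.frobeniusAlgEquivOfAlgebraic F E) x]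
  simp

lemma exists_eq_pow_card_pow_of_minpoly_eq {x y : E} (h : minpoly F x = minpoly F y) :
    ∃ j < Module.finrank F E, y = x ^ Fintype.card F ^ j := by
  obtain ⟨σ, hσ⟩ := Normal.minpoly_eq_iff_mem_orbit (F := F) E |>.mp h.symm
  obtain ⟨j, rfl⟩ := (FiniteField.bijective_frobeniusAlgEquivOfAlgebraic_pow F E).2 σ
  refine ⟨j, j.2, ?_⟩
  rw [← hσ]
  simp [AlgEquiv.smul_def, AlgEquiv.coe_pow, FiniteField.coe_frobeniusAlgEquivOfAlgebraic_iterate]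

lemma pow_card_pow_natDegree_minpoly (x : E) :
    x ^ Fintype.card F ^ (minpoly F x).natDegree = x := by
  have hx : IsIntegral F x := Algebra.IsIntegral.isIntegral x
  rw [← IntermediateField.adjoin.finrank hx]
  have : Fintype (IntermediateField.adjoin F {x}) := Fintype.ofFinite _
  rw [← Module.card_eq_pow_finrank]
  exact congrArg Subtype.val (FiniteField.pow_card (IntermediateField.AdjoinSimple.gen F x))

end FiniteField

theorem stmt3 (q m : ℕ) (hq : Odd q) (hpp : IsPrimePow q) (hm : 2 ≤ m)
    (F E : Type) [Field F] [Fintype F] [DecidableEq F] [Field E] [Fintype E] [Algebra F E]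
    (hF : Fintype.card F = q) (hE : Fintype.card E = q ^ m)
    (n : ℕ) (hn : n = (q ^ m - 1) / 2)
    (β : E) (hβ : IsPrimitiveRoot β (q ^ m - 1))
    (δ : ℕ) (hδ2 : 2 ≤ δ)
    (hδe : Even m → δ ≤ q ^ (m / 2) + 1)
    (hδo : Odd m → δ ≤ (q ^ ((m + 1) / 2) + 1) / 2)
    (g : Polynomial F)
    (hg : g = Finset.lcm (Finset.range (δ - 1)) (fun i => minpoly F (β ^ (1 + 2 * i)))) :
    g = ∏ i ∈ (Finset.range (δ - 1)).filter (fun i => ¬ i % q = (q - 1) / 2),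
          minpoly F (β ^ (1 + 2 * i)) ∧
    g.natDegree = m * (((2 * δ - 3) * (q - 1) + (2 * q - 1)) / (2 * q)) ∧
    MinDistLB g n (if δ % q = (q + 1) / 2 then δ + 1 else δ) := by
  have hq3 : 3 ≤ q := by
    have := hpp.one_lt
    obtain ⟨k, rfl⟩ := hq
    omega
  have hfin : Module.finrank F E = m := by
    have h := Module.card_eq_pow_finrank (K := F) (V := E)
    rw [hE, hF] at h
    exact (Nat.pow_right_injective hpp.two_le h).symm
  have hlt := two_mul_sub_three_lt hq3 hm hδe hδo
  have hpow : ∀ s t, β ^ s = β ^ t → s ≡ t [MOD q ^ m - 1] := fun s t h => by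
    rw [hβ.eq_orderOf]
    exact (hβ.isOfFinOrder (by omega)).pow_inj_mod.mp h
  have hndvd : ∀ i, ¬ i % q = (q - 1) / 2 → ¬ q ∣ 1 + 2 * i := fun i hi hdvd =>
    hi ((dvd_one_add_two_mul_iff hq i).mp hdvd)
  set S := (Finset.range (δ - 1)).filter (fun i => ¬ i % q = (q - 1) / 2) with hS
  have hSmem : ∀ i ∈ S, 1 + 2 * i ≤ 2 * δ - 3 ∧ ¬ q ∣ 1 + 2 * i := fun i hi => by
    rw [hS, Finset.mem_filter, Finset.mem_range] at hi
    exact ⟨by omega, hndvd i hi.2⟩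
  have hodd : ∀ i, Odd (1 + 2 * i) := fun i => ⟨i, by ring⟩
  have hcoset : ∀ i ∈ S, ∀ i' ∈ S, ∀ j, 0 < j → j < m →
      β ^ (1 + 2 * i') ≠ (β ^ (1 + 2 * i)) ^ q ^ j := fun i hi i' hi' j hj0 hjm h =>
    mul_pow_not_modEq hq3 hq hδ2 hδe hδo hj0 hjm (hSmem i hi).1 (hSmem i' hi').1
      (hodd i) (hodd i') (hSmem i hi).2 (hSmem i' hi').2 (hpow _ _ (by rw [h, pow_mul]))
  have hint : ∀ x : E, IsIntegral F x := fun x => Algebra.IsIntegral.isIntegral x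
  have hdeg : ∀ i ∈ S, (minpoly F (β ^ (1 + 2 * i))).natDegree = m := fun i hi => by
    by_contra hne
    have hle := minpoly.natDegree_le (A := F) (β ^ (1 + 2 * i))
    rw [hfin] at hle
    refine hcoset i hi i hi _ (minpoly.natDegree_pos (hint (β ^ (1 + 2 * i)))) (by omega) ?_
    rw [← hF, pow_card_pow_natDegree_minpoly]
  have hinj : ∀ i ∈ S, ∀ i' ∈ S, minpoly F (β ^ (1 + 2 * i)) = minpoly F (β ^ (1 + 2 * i')) →
      i = i' := fun i hi i' hi' h => by
    obtain ⟨j, hjm, hj⟩ := exists_eq_pow_card_pow_of_minpoly_eq h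
    rw [hfin] at hjm
    rw [hF] at hj
    rcases Nat.eq_zero_or_pos j with rfl | hj0
    · rw [pow_zero, pow_one] at hj
      have := (hpow _ _ hj).eq_of_lt_of_lt ((hSmem i' hi').1.trans_lt hlt)
        ((hSmem i hi).1.trans_lt hlt)
      omega
    · exact (hcoset i hi i' hi' j hj0 hjm hj).elim
  have hreduce : ∀ i, i % q = (q - 1) / 2 →
      ∃ i', 1 + 2 * i = q * (1 + 2 * i') ∧
        minpoly F (β ^ (1 + 2 * i)) = minpoly F (β ^ (1 + 2 * i')) := fun i hi => by
    obtain ⟨c, hc⟩ := (dvd_one_add_two_mul_iff hq i).mpr hi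
    obtain ⟨i', rfl⟩ := (Nat.odd_mul.mp (hc ▸ hodd i)).2
    refine ⟨i', by rw [hc]; ring, ?_⟩
    rw [hc, mul_comm q, pow_mul, ← hF, minpoly_pow_card, add_comm]
  set P := ∏ i ∈ S, minpoly F (β ^ (1 + 2 * i)) with hP
  have hPm : P.Monic := monic_prod_of_monic _ _ fun i _ => minpoly.monic (hint _)
  have hdvdP : ∀ i < δ - 1, minpoly F (β ^ (1 + 2 * i)) ∣ P := fun i => by
    induction i using Nat.strong_induction_on with
    | _ i ih =>
      intro hi
      by_cases h : i % q = (q - 1) / 2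
      · obtain ⟨i', hi', he⟩ := hreduce i h
        have : 3 * (1 + 2 * i') ≤ q * (1 + 2 * i') := Nat.mul_le_mul_right _ hq3
        rw [he]
        exact ih i' (by omega) (by omega)
      · exact Finset.dvd_prod_of_mem _ (by simp [hS, hi, h])
  have hgP : g = P := by
    refine dvd_antisymm_of_normalize_eq ?_ hPm.normalize_eq_self ?_ ?_
    · rw [hg, Finset.normalize_lcm]
    · rw [hg]
      exact Finset.lcm_dvd fun i hi => hdvdP i (Finset.mem_range.mp hi)
    · refine Finset.prod_dvd_of_coprime ?_ ?_
      · intro i hi i' hi' hne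
        have hirr := minpoly.irreducible (hint (β ^ (1 + 2 * i)))
        have hirr' := minpoly.irreducible (hint (β ^ (1 + 2 * i')))
        refine hirr.coprime_iff_not_dvd.mpr fun hd => hne (hinj i hi i' hi' ?_)
        exact eq_of_monic_of_associated (minpoly.monic (hint _)) (minpoly.monic (hint _))
          (hirr.associated_of_dvd hirr' hd)
      · intro i hi
        rw [hg]
        exact Finset.dvd_lcm (Finset.mem_of_mem_filter i hi)
  refine ⟨hgP, ?_, ?_⟩
  · rw [hgP, hP, natDegree_prod_of_monic _ _ fun i _ => minpoly.monic (hint _),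
      Finset.sum_congr rfl hdeg, Finset.sum_const, smul_eq_mul, hS,
      card_filter_range_mod_ne q (δ - 1) hq (by omega), mul_comm,
      show 2 * (δ - 1) - 1 = 2 * δ - 3 by omega]
  · intro c hc hgc hcn
    have hβ0 : β ≠ 0 := hβ.ne_zero (by omega)
    have hqm : Odd (q ^ m) := hq.pow
    have hγ : IsPrimitiveRoot (β ^ 2) n :=
      hβ.pow (by omega) (by obtain ⟨k, hk⟩ := hqm; omega)
    have hroot : ∀ i < δ - 1, aeval (β * (β ^ 2) ^ i) c = 0 := fun i hi => by
      rw [← pow_mul, ← pow_succ', add_comm]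
      exact (minpoly.dvd_iff (A := F)).mp ((hdvdP i hi).trans (hgP ▸ hgc))
    split_ifs with h
    · refine Nat.succ_le_of_lt (lt_card_support_of_aeval_eq_zero hβ0 hγ hc hcn fun i hi => ?_)
      rcases Nat.lt_or_ge i (δ - 1) with hi' | hi'
      · exact hroot i hi'
      · obtain rfl : δ = i + 1 := by omega
        have hiq : i % q = (q - 1) / 2 := by
          rw [← dvd_one_add_two_mul_iff hq]
          have hd := Nat.div_add_mod (i + 1) q
          rw [h] at hd
          refine ⟨2 * ((i + 1) / q) + 1, ?_⟩
          obtain ⟨k, rfl⟩ := hq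
          rw [show (2 * k + 1 + 1) / 2 = k + 1 by omega] at hd
          linarith
        obtain ⟨i', hi', he⟩ := hreduce i hiq
        have : 3 * (1 + 2 * i') ≤ q * (1 + 2 * i') := Nat.mul_le_mul_right _ hq3
        rw [← pow_mul, ← pow_succ', add_comm, ← minpoly.dvd_iff (A := F), he]
        exact (hdvdP i' (by omega)).trans (hgP ▸ hgc)
    · have := lt_card_support_of_aeval_eq_zero hβ0 hγ hc hcn hroot
      omega
end

section
/- Let q be an odd prime power and m ≥ 2. Then δ1 = (q−1)q^{m−1} − 1 is the largest odd coset leader modulo q^m − 1; that is, δ1 is odd, δ1 is a coset leader modulo q^m − 1, and every odd coset leader modulo q^m − 1 is at most δ1. -/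
/-- `i` is the smallest element of its `q`-cyclotomic coset modulo `N`,
i.e. `i < N` and `i ≤ i·q^j mod N` for all `j`. -/
def IsCosetLeader (q N i : ℕ) : Prop :=
  i < N ∧ ∀ j : ℕ, i ≤ (i * q ^ j) % N

lemma pow_modEq_pow_mod (q m n : ℕ) (hq : 0 < q) :
    q ^ n ≡ q ^ (n % m) [MOD q ^ m - 1] := by
  have h : q ^ m ≡ 1 [MOD q ^ m - 1] :=
    ((Nat.modEq_iff_dvd' (Nat.one_le_pow _ _ hq)).2 dvd_rfl).symm
  conv_lhs => rw [← Nat.mod_add_div n m, pow_add, pow_mul]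
  simpa using (Nat.ModEq.refl (q ^ (n % m))).mul (h.pow (n / m))

lemma isCosetLeader_sub_pow (q m : ℕ) (hq : 2 ≤ q) (hm : 2 ≤ m) :
    IsCosetLeader q (q ^ m - 1) (q ^ m - 1 - q ^ (m - 1)) := by
  have hlt : q ^ (m - 1) < q ^ m := Nat.pow_lt_pow_right hq (by omega)
  have hpos : 0 < q ^ (m - 1) := by positivity
  refine ⟨by omega, fun j ↦ ?_⟩
  set N := q ^ m - 1 with hN
  set x := (N - q ^ (m - 1)) * q ^ j % N with hx
  have hr : (m - 1 + j) % m < m := Nat.mod_lt _ (by omega)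
  have hle : q ^ ((m - 1 + j) % m) ≤ q ^ (m - 1) :=
    Nat.pow_le_pow_right (by omega) (by omega)
  have hdvd : N ∣ x + q ^ ((m - 1 + j) % m) := by
    rw [← Nat.modEq_zero_iff_dvd]
    calc x + q ^ ((m - 1 + j) % m)
        ≡ (N - q ^ (m - 1)) * q ^ j + q ^ (m - 1 + j) [MOD N] :=
          (Nat.mod_modEq _ _).add (pow_modEq_pow_mod q m _ (by omega)).symm
      _ = N * q ^ j := by
          rw [pow_add, ← add_mul, Nat.sub_add_cancel (by omega)]
      _ ≡ 0 [MOD N] := (Nat.modEq_zero_iff_dvd).2 (dvd_mul_right _ _)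
  have := Nat.le_of_dvd (by positivity) hdvd
  omega

lemma IsCosetLeader.le_sub_pow {q m i : ℕ} (hq : 2 ≤ q) (hm : 2 ≤ m)
    (hi : IsCosetLeader q (q ^ m - 1) i) : i ≤ q ^ m - 1 - q ^ (m - 1) := by
  obtain ⟨hlt, hmin⟩ := hi
  by_contra! hgt
  obtain ⟨k, hk⟩ := Nat.exists_eq_add_of_lt hlt
  have hpow : q ^ m = q ^ (m - 1) * q := by rw [← pow_succ, Nat.sub_add_cancel (by omega)]
  have hkq : (k + 1) * q + q ≤ q ^ m := by
    rw [hpow, ← Nat.succ_mul]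
    exact Nat.mul_le_mul_right _ (by omega)
  have h2 : (k + 1) * 2 ≤ (k + 1) * q := Nat.mul_le_mul_left _ hq
  have hmod : i * q ^ 1 % (q ^ m - 1) = q ^ m - 1 - (k + 1) * q := by
    have : i * q ^ 1 = (q ^ m - 1 - (k + 1) * q) + (q ^ m - 1) * (q - 1) := by
      have hle : (k + 1) * q ≤ q ^ m - 1 := by omega
      rw [hk] at hle ⊢
      zify [hle, show 1 ≤ q by omega]
      ring
    rw [this, Nat.add_mul_mod_self_left, Nat.mod_eq_of_lt (by omega)]
  have := hmin 1
  omega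

theorem stmt4 (q m : ℕ) (hq : Odd q) (hpp : IsPrimePow q) (hm : 2 ≤ m) :
    Odd ((q - 1) * q ^ (m - 1) - 1) ∧
    IsCosetLeader q (q ^ m - 1) ((q - 1) * q ^ (m - 1) - 1) ∧
    ∀ i : ℕ, Odd i → IsCosetLeader q (q ^ m - 1) i → i ≤ (q - 1) * q ^ (m - 1) - 1 := by
  have hq2 : 2 ≤ q := hpp.two_le
  have heq : (q - 1) * q ^ (m - 1) - 1 = q ^ m - 1 - q ^ (m - 1) := by
    rw [Nat.sub_mul, one_mul, ← pow_succ', Nat.sub_add_cancel (by omega), Nat.sub_right_comm]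
  refine ⟨?_, heq ▸ isCosetLeader_sub_pow q m hq2 hm, fun i _ hi ↦ heq ▸ hi.le_sub_pow hq2 hm⟩
  refine Nat.Even.sub_odd ?_ ((Nat.Odd.sub_odd hq odd_one).mul_right _) odd_one
  exact Nat.mul_pos (by omega) (by positivity)
end

section
/- Let q be an odd prime power and m ≥ 2. (i) For every 1 ≤ i ≤ m there exists a coset leader S modulo q^m − 1 with q-weight w_q(S) = (q−1)m − i. (ii) For 1 ≤ i ≤ m−1, if M_i is the largest coset leader modulo q^m − 1 with q-weight (q−1)m − i and M_{i+1} is the largest coset leader modulo q^m − 1 with q-weight (q−1)m − (i+1), then M_i > M_{i+1}. -/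
/-- The `q`-weight of `s`: the sum of the digits of the base-`q` expansion of `s`. -/
def qWeight (q s : ℕ) : ℕ := (Nat.digits q s).sum

/-- `M` is the largest coset leader modulo `N` whose `q`-weight equals `w`. -/
def IsGreatestLeaderOfWeight (q N w M : ℕ) : Prop :=
  IsCosetLeader q N M ∧ qWeight q M = w ∧
  ∀ S : ℕ, IsCosetLeader q N S → qWeight q S = w → S ≤ M

/-- The number `∑ k < m, d k * q ^ k` whose base-`q` digits are `d 0, …, d (m - 1)`. -/
def digitValue (q m : ℕ) (d : ℕ → ℕ) : ℕ := ∑ k ∈ Finset.range m, d k * q ^ k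

theorem digitValue_succ (q m : ℕ) (d : ℕ → ℕ) :
    digitValue q (m + 1) d = d 0 + q * digitValue q m (fun k => d (k + 1)) := by
  unfold digitValue
  rw [Finset.sum_range_succ', Finset.mul_sum, add_comm]
  congr 1
  · simp
  · exact Finset.sum_congr rfl fun k _ => by ring

theorem qWeight_add_mul {q : ℕ} (hq : 1 < q) {a : ℕ} (ha : a < q) (x : ℕ) :
    qWeight q (a + q * x) = a + qWeight q x := by
  by_cases h : a = 0 ∧ x = 0
  · simp [h.1, h.2]
  · unfold qWeight
    rw [Nat.digits_add q hq a x ha (by tauto), List.sum_cons]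

theorem qWeight_digitValue {q : ℕ} (hq : 1 < q) (m : ℕ) :
    ∀ d : ℕ → ℕ, (∀ k, d k < q) → qWeight q (digitValue q m d) = ∑ k ∈ Finset.range m, d k := by
  induction m with
  | zero => simp [digitValue, qWeight]
  | succ m ih =>
    intro d hd
    rw [digitValue_succ, qWeight_add_mul hq (hd 0), ih _ fun k => hd (k + 1),
      Finset.sum_range_succ', add_comm]

theorem exists_digitValue_eq {q : ℕ} (hq : 1 < q) (m : ℕ) :
    ∀ x < q ^ m, ∃ d : ℕ → ℕ, (∀ k, d k < q) ∧ digitValue q m d = x := by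
  induction m with
  | zero => exact fun x hx => ⟨fun _ => 0, fun _ => hq.pos, by simp_all [digitValue]⟩
  | succ m ih =>
    intro x hx
    obtain ⟨d, hd, hdx⟩ := ih (x / q) (Nat.div_lt_of_lt_mul (by rwa [pow_succ'] at hx))
    refine ⟨fun k => Nat.casesOn k (x % q) d, ?_, ?_⟩
    · rintro (_ | k)
      · exact Nat.mod_lt _ (by omega)
      · exact hd k
    · rw [digitValue_succ]
      change x % q + q * digitValue q m d = x
      rw [hdx, Nat.mod_add_div]

theorem exists_periodic_digitValue_eq {q m : ℕ} (hq : 1 < q) {x : ℕ} (hx : x < q ^ m) :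
    ∃ d : ℕ → ℕ, Function.Periodic d m ∧ (∀ k, d k < q) ∧ digitValue q m d = x := by
  obtain ⟨d, hd, hdx⟩ := exists_digitValue_eq hq m x hx
  refine ⟨fun k => d (k % m), fun k => by simp, fun k => hd _, ?_⟩
  rw [← hdx]
  exact Finset.sum_congr rfl fun k hk => by simp only [Nat.mod_eq_of_lt (Finset.mem_range.1 hk)]

theorem sum_range_shift {d : ℕ → ℕ} {m : ℕ} (hd : Function.Periodic d m) (j : ℕ) :
    ∑ k ∈ Finset.range m, d (k + j) = ∑ k ∈ Finset.range m, d k := by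
  induction j with
  | zero => rfl
  | succ j ih =>
    rw [← ih]
    have h := Finset.sum_range_succ' (fun k => d (k + j)) m
    rw [Finset.sum_range_succ] at h
    have h0 : d (m + j) = d (0 + j) := by rw [add_comm m, hd j, zero_add]
    simp only [add_right_comm _ 1 j] at h
    simp only [← add_assoc, add_right_comm _ j 1] at h ⊢
    omega

theorem mul_digitValue_shift_modEq {q m : ℕ} (hq : 0 < q) {d : ℕ → ℕ}
    (hd : Function.Periodic d m) :
    q * digitValue q m (fun k => d (k + 1)) ≡ digitValue q m d [MOD q ^ m - 1] := by
  have h : digitValue q (m + 1) d = digitValue q m d + d 0 * q ^ m := by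
    rw [digitValue, Finset.sum_range_succ, ← digitValue, ← hd 0, zero_add]
  rw [digitValue_succ] at h
  have hN : 1 ≤ q ^ m := Nat.one_le_pow _ _ hq
  obtain ⟨N, hN⟩ := Nat.exists_eq_add_of_le hN
  have : q * digitValue q m (fun k => d (k + 1)) = digitValue q m d + (q ^ m - 1) * d 0 := by
    rw [hN] at h ⊢
    simp only [Nat.add_sub_cancel_left]
    linarith
  rw [this]
  simp [Nat.ModEq]

theorem digitValue_shift_modEq {q m : ℕ} (hq : 0 < q) {d : ℕ → ℕ}
    (hd : Function.Periodic d m) (j : ℕ) :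
    q ^ j * digitValue q m (fun k => d (k + j)) ≡ digitValue q m d [MOD q ^ m - 1] := by
  induction j with
  | zero => simpa using Nat.ModEq.refl _
  | succ j ih =>
    refine Nat.ModEq.trans ?_ ih
    have hd' : Function.Periodic (fun k => d (k + j)) m := fun k => by
      simp only [add_right_comm k m j, hd (k + j)]
    have h := (mul_digitValue_shift_modEq hq hd').mul_left (q ^ j)
    simpa only [pow_succ, mul_assoc, add_right_comm _ 1 j, ← add_assoc] using h

theorem digitValue_lt {q m : ℕ} (hq : 1 < q) {d : ℕ → ℕ} (hd : ∀ k, d k < q)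
    (hs : ∑ k ∈ Finset.range m, d k < (q - 1) * m) : digitValue q m d < q ^ m - 1 := by
  have h1 : ∑ k ∈ Finset.range m, (q - 1) * q ^ k = q ^ m - 1 := by
    rw [← Finset.mul_sum, mul_comm, Nat.geomSum_eq hq, Nat.div_mul_cancel]
    simpa using Nat.sub_dvd_pow_sub_pow q 1 m
  obtain ⟨k, hk, hlt⟩ : ∃ k ∈ Finset.range m, d k < q - 1 := by
    apply Finset.exists_lt_of_sum_lt
    simpa [mul_comm] using hs
  rw [← h1]
  exact Finset.sum_lt_sum (fun k _ => Nat.mul_le_mul_right _ (by have := hd k; omega))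
    ⟨k, hk, Nat.mul_lt_mul_of_pos_right hlt (by positivity)⟩

/-- Multiplying by `q ^ j` modulo `q ^ m - 1` rotates the digits. -/
theorem digitValue_mul_pow_mod {q m : ℕ} (hq : 1 < q) (hm : 1 ≤ m) {d : ℕ → ℕ}
    (hp : Function.Periodic d m) (hd : ∀ k, d k < q)
    (hs : ∑ k ∈ Finset.range m, d k < (q - 1) * m) (j : ℕ) :
    digitValue q m d * q ^ j % (q ^ m - 1) = digitValue q m (fun k => d (k + j * (m - 1))) := by
  have hp' : Function.Periodic (fun k => d (k + j * (m - 1))) m := fun k => by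
    simp only [add_right_comm k m, hp (k + j * (m - 1))]
  have h := digitValue_shift_modEq (by omega : 0 < q) hp' j
  have hd' : (fun k => d (k + j + j * (m - 1))) = d := by
    funext k
    have : k + j + j * (m - 1) = k + j * m := by
      obtain ⟨n, rfl⟩ := Nat.exists_eq_add_of_le hm
      simp only [Nat.add_sub_cancel_left]
      ring
    rw [this]
    exact hp.nat_mul j k
  rw [hd', mul_comm] at h
  rw [h, Nat.mod_eq_of_lt]
  exact digitValue_lt hq (fun k => hd _) (by rwa [sum_range_shift hp])

/-- Every periodic digit sequence other than the constant `q - 1` has a rotation whose value is a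
coset leader. -/
theorem exists_isCosetLeader_shift {q m : ℕ} (hq : 1 < q) (hm : 1 ≤ m) {d : ℕ → ℕ}
    (hp : Function.Periodic d m) (hd : ∀ k, d k < q)
    (hs : ∑ k ∈ Finset.range m, d k < (q - 1) * m) :
    ∃ j, IsCosetLeader q (q ^ m - 1) (digitValue q m (fun k => d (k + j * (m - 1)))) := by
  obtain ⟨j, hj⟩ := exists_minimalFor_of_wellFoundedLT (fun _ : ℕ => True)
    (fun j => digitValue q m (fun k => d (k + j * (m - 1)))) ⟨0, trivial⟩
  refine ⟨j, digitValue_lt hq (fun k => hd _) (by rwa [sum_range_shift hp]), fun i => ?_⟩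
  have hle : digitValue q m (fun k => d (k + j * (m - 1))) ≤
      digitValue q m (fun k => d (k + (j + i) * (m - 1))) :=
    not_lt.1 fun h => absurd (hj.2 trivial h.le) (not_le.2 h)
  simp only [← digitValue_mul_pow_mod hq hm hp hd hs] at hle ⊢
  rwa [Nat.mod_mul_mod, mul_assoc, ← pow_add]

theorem exists_isCosetLeader_qWeight {q m : ℕ} (hq : 3 ≤ q) {i : ℕ} (hi : 1 ≤ i) (him : i ≤ m) :
    ∃ S : ℕ, IsCosetLeader q (q ^ m - 1) S ∧ qWeight q S = (q - 1) * m - i := by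
  have hle : m ≤ (q - 1) * m := Nat.le_mul_of_pos_left _ (by omega)
  let d : ℕ → ℕ := fun k => if k % m < i then q - 2 else q - 1
  have hp : Function.Periodic d m := fun k => by simp [d]
  have hd : ∀ k, d k < q := fun k => by simp only [d]; split_ifs <;> omega
  have hs : ∑ k ∈ Finset.range m, d k = (q - 1) * m - i := by
    have h1 : ∀ k, d k + (if k % m < i then 1 else 0) = q - 1 := fun k => by
      simp only [d]; split_ifs <;> omega
    have h2 : ∑ k ∈ Finset.range m, (if k % m < i then 1 else 0) = i := by
      rw [Finset.sum_congr rfl fun k hk => by rw [Nat.mod_eq_of_lt (Finset.mem_range.1 hk)],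
        ← Finset.card_filter]
      have : (Finset.range m).filter (· < i) = Finset.range i := by
        ext k; simp only [Finset.mem_filter, Finset.mem_range]; omega
      rw [this, Finset.card_range]
    have h3 : ∑ k ∈ Finset.range m, (d k + (if k % m < i then 1 else 0)) = (q - 1) * m := by
      simp [h1, mul_comm]
    rw [Finset.sum_add_distrib, h2] at h3
    omega
  obtain ⟨j, hj⟩ := exists_isCosetLeader_shift (by omega) (by omega) hp hd (by omega)
  exact ⟨_, hj, by rw [qWeight_digitValue (by omega) _ _ fun k => hd _, sum_range_shift hp, hs]⟩

/-- Raising one digit of a coset leader and rotating yields a strictly larger coset leader. -/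
theorem IsCosetLeader.exists_gt_qWeight_succ {q m : ℕ} (hq : 1 < q) {M : ℕ}
    (hM : IsCosetLeader q (q ^ m - 1) M) (hw : qWeight q M + 1 < (q - 1) * m) :
    ∃ S, IsCosetLeader q (q ^ m - 1) S ∧ qWeight q S = qWeight q M + 1 ∧ M < S := by
  have hm : 1 ≤ m := Nat.one_le_iff_ne_zero.2 fun h => by simp [h] at hw
  obtain ⟨d, hp, hd, rfl⟩ := exists_periodic_digitValue_eq hq (hM.1.trans_le (Nat.sub_le _ _))
  rw [qWeight_digitValue hq _ _ hd] at hw ⊢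
  obtain ⟨t, ht, htlt⟩ : ∃ t ∈ Finset.range m, d t < q - 1 := by
    apply Finset.exists_lt_of_sum_lt
    simp only [Finset.sum_const, Finset.card_range, smul_eq_mul]
    rw [mul_comm m]
    omega
  have htm := Finset.mem_range.1 ht
  let c : ℕ → ℕ := fun k => d k + if k % m = t then 1 else 0
  have hpc : Function.Periodic c m := fun k => by simp [c, hp k]
  have hc : ∀ k, c k < q := fun k => by
    have := hd k
    simp only [c]
    split_ifs with h
    · have : d k = d t := by rw [← h, hp.map_mod_nat]
      omega
    · omega
  have hs : ∑ k ∈ Finset.range m, c k = ∑ k ∈ Finset.range m, d k + 1 := by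
    simp only [c, Finset.sum_add_distrib]
    congr 1
    rw [Finset.sum_congr rfl fun k hk => by rw [Nat.mod_eq_of_lt (Finset.mem_range.1 hk)]]
    simp [htm]
  obtain ⟨j, hj⟩ := exists_isCosetLeader_shift hq hm hpc hc (by omega)
  refine ⟨_, hj, by rw [qWeight_digitValue hq _ _ fun k => hc _, sum_range_shift hpc, hs], ?_⟩
  refine (hM.2 j).trans_lt ?_
  rw [digitValue_mul_pow_mod hq hm hp hd (by omega)]
  have hdc : ∀ k, d k ≤ c k := fun k => Nat.le_add_right _ _
  obtain ⟨k, hk, hlt⟩ : ∃ k ∈ Finset.range m, d (k + j * (m - 1)) < c (k + j * (m - 1)) := by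
    apply Finset.exists_lt_of_sum_lt
    rw [sum_range_shift hp, sum_range_shift hpc, hs]
    omega
  exact Finset.sum_lt_sum (fun k _ => Nat.mul_le_mul_right _ (hdc _))
    ⟨k, hk, Nat.mul_lt_mul_of_pos_right hlt (by positivity)⟩

theorem stmt5 (q m : ℕ) (hq : Odd q) (hpp : IsPrimePow q) (hm : 2 ≤ m) :
    (∀ i : ℕ, 1 ≤ i → i ≤ m →
      ∃ S : ℕ, IsCosetLeader q (q ^ m - 1) S ∧ qWeight q S = (q - 1) * m - i) ∧
    (∀ i : ℕ, 1 ≤ i → i ≤ m - 1 → ∀ M M' : ℕ,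
      IsGreatestLeaderOfWeight q (q ^ m - 1) ((q - 1) * m - i) M →
      IsGreatestLeaderOfWeight q (q ^ m - 1) ((q - 1) * m - (i + 1)) M' →
      M' < M) := by
  have hq3 : 3 ≤ q := by
    have := hpp.one_lt
    obtain ⟨r, rfl⟩ := hq
    omega
  refine ⟨fun i hi him => exists_isCosetLeader_qWeight hq3 hi him, fun i hi him M M' hM hM' => ?_⟩
  have hle : m ≤ (q - 1) * m := Nat.le_mul_of_pos_left _ (by omega)
  obtain ⟨S, hS, hSw, hlt⟩ := hM'.1.exists_gt_qWeight_succ (by omega) (by rw [hM'.2.1]; omega)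
  exact hlt.trans_le (hM.2.2 S hS (by rw [hSw, hM'.2.1]; omega))
end

section
/- Let q ≥ 3 be an odd prime power and m ≥ 2. Then δ2 = (q−1)q^{m−1} − q^{⌊(2m−1)/3⌋} − q^{⌊(m−1)/3⌋} − 1 is the second largest odd coset leader modulo q^m − 1; that is, δ2 is odd, δ2 is a coset leader modulo q^m − 1, δ2 < (q−1)q^{m−1} − 1, and every odd coset leader modulo q^m − 1 other than (q−1)q^{m−1} − 1 is at most δ2. -/
theorem mul_mod_eq_sub_of_dvd_add {N x R : ℕ} (hR : 0 < R) (hRN : R ≤ N) (h : N ∣ x + R) :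
    x % N = N - R := by
  have hs : x % N < N := Nat.mod_lt _ (by omega)
  have hdvd : N ∣ x % N + R := by
    rw [← Nat.mod_add_div x N] at h
    have h2 : x % N + N * (x / N) + R = x % N + R + N * (x / N) := by ring
    rw [h2] at h
    exact (Nat.dvd_add_left (Dvd.intro _ rfl)).mp h
  obtain ⟨d, hd⟩ := hdvd
  have hd1 : d = 1 := by
    have h0 : 0 < d := by
      rcases Nat.eq_zero_or_pos d with rfl | h0
      · omega
      · exact h0
    have h2 : d < 2 := by
      by_contra! h2
      have := Nat.mul_le_mul_left N h2
      omega
    omega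
  subst hd1
  omega

/-- The complement of a coset leader modulo `q ^ m - 1` dominates each rotation of its
base-`q` expansion. -/
theorem IsCosetLeader.rotation_le {q m i k : ℕ} (hq : 0 < q) (h : IsCosetLeader q (q ^ m - 1) i)
    (hk : i + k = q ^ m - 1) {p x y : ℕ} (hp : p < m) (hx : x < q ^ (p + 1))
    (hkxy : k = q ^ (p + 1) * y + x) : x * q ^ (m - 1 - p) + y ≤ k := by
  obtain ⟨hi, h⟩ := h
  set j := m - 1 - p with hj
  have hpow : q ^ m = q ^ (p + 1) * q ^ j := by rw [← pow_add]; congr 1; omega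
  have hpos : 0 < q ^ (p + 1) := by positivity
  have hposj : 0 < q ^ j := by positivity
  have hkpos : 0 < k := by omega
  have hy : y < q ^ j := by
    by_contra! hy
    have := Nat.mul_le_mul_left (q ^ (p + 1)) hy
    omega
  have hR : 0 < x * q ^ j + y := by
    rcases Nat.eq_zero_or_pos x with rfl | h0
    · rcases Nat.eq_zero_or_pos y with rfl | h1
      · simp at hkxy; omega
      · omega
    · positivity
  have hRN : x * q ^ j + y ≤ q ^ m - 1 := by
    have := Nat.mul_le_mul_right (q ^ j) (Nat.succ_le_of_lt hx)
    rw [Nat.succ_mul] at this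
    omega
  have hdvd : q ^ m - 1 ∣ i * q ^ j + (x * q ^ j + y) := by
    have h1 : (i + k) * q ^ j + y = i * q ^ j + (x * q ^ j + y) + y * q ^ m := by
      rw [hkxy, hpow]; ring
    have h2 : y * q ^ m = y * (q ^ m - 1) + y := by
      have : q ^ m = (q ^ m - 1) + 1 := by omega
      conv_lhs => rw [this]
      ring
    have h3 : (q ^ m - 1) * q ^ j = i * q ^ j + (x * q ^ j + y) + y * (q ^ m - 1) := by
      rw [← hk] at *; omega
    have h4 : q ^ m - 1 ∣ i * q ^ j + (x * q ^ j + y) + y * (q ^ m - 1) := ⟨_, h3.symm⟩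
    exact (Nat.dvd_add_left (Dvd.intro_left _ rfl)).mp h4
  have := h j
  rw [mul_mod_eq_sub_of_dvd_add hR hRN hdvd] at this
  omega

theorem pow_le_of_complement_leader {q m i k : ℕ} (hq : 2 ≤ q)
    (h : IsCosetLeader q (q ^ m - 1) i) (hk : i + k = q ^ m - 1) : q ^ (m - 1) ≤ k := by
  have hk0 : k ≠ 0 := by have := h.1; omega
  set s := Nat.log q k
  have h1 : q ^ s ≤ k := Nat.pow_log_le_self q hk0
  have h2 : k < q ^ (s + 1) := Nat.lt_pow_succ_log_self (by omega) k
  have hsm : s < m := by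
    have : q ^ s < q ^ m := by omega
    exact (Nat.pow_lt_pow_iff_right (by omega)).mp this
  have h3 := h.rotation_le (by omega) hk (p := s) (x := k) (y := 0) hsm h2 (by simp)
  have h4 : q ^ (m - 1) = q ^ s * q ^ (m - 1 - s) := by rw [← pow_add]; congr 1; omega
  have h5 := Nat.mul_le_mul_right (q ^ (m - 1 - s)) h1
  omega

theorem complement_le_of_odd_leader {q m i k : ℕ} (hqo : Odd q) (hq : 3 ≤ q) (hm : 2 ≤ m)
    (h : IsCosetLeader q (q ^ m - 1) i) (hk : i + k = q ^ m - 1) (hko : Odd k)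
    (hne : k ≠ q ^ (m - 1)) :
    q ^ (m - 1) + q ^ ((2 * m - 1) / 3) + q ^ ((m - 1) / 3) ≤ k := by
  by_contra! hlt
  have hq1 : 1 < q := by omega
  have hmono : ∀ {u v : ℕ}, u ≤ v → q ^ u ≤ q ^ v := fun huv => Nat.pow_le_pow_right (by omega) huv
  have hinj : ∀ {u v : ℕ}, q ^ u < q ^ v → u < v := fun huv => (Nat.pow_lt_pow_iff_right hq1).mp huv
  have hge := pow_le_of_complement_leader (by omega) h hk
  have hthree : ∀ u, 3 * q ^ u ≤ q ^ (u + 1) := fun u => by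
    rw [pow_succ, mul_comm]; exact Nat.mul_le_mul_left _ hq
  obtain ⟨r, rfl⟩ := Nat.exists_eq_add_of_le hge
  have hodd : ∀ u, Odd (q ^ u) := fun u => hqo.pow
  have hre : Even r := by
    have := hodd (m - 1)
    grind
  have hr0 : r ≠ 0 := by omega
  have hrlt : r < q ^ (m - 1) := by
    rcases Nat.lt_or_ge 2 m with hm3 | hm2
    · have h1 := hmono (show (2 * m - 1) / 3 ≤ m - 2 by omega)
      have h2 := hmono (show (m - 1) / 3 ≤ m - 2 by omega)
      have h3 := hthree (m - 2)
      rw [show m - 2 + 1 = m - 1 by omega] at h3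
      omega
    · obtain rfl : m = 2 := by omega
      norm_num at hlt ⊢
      grind
  set p := Nat.log q r
  have hp1 : q ^ p ≤ r := Nat.pow_log_le_self q hr0
  have hp2 : r < q ^ (p + 1) := Nat.lt_pow_succ_log_self hq1 r
  clear_value p
  have hpm : p < m - 1 := hinj (by omega)
  have hrot := h.rotation_le (by omega) hk (p := p) (x := r) (y := q ^ (m - 2 - p))
    (by omega) hp2 (by rw [← pow_add]; congr 2; omega)
  have hpp : q ^ (m - 1) = q ^ p * q ^ (m - 1 - p) := by rw [← pow_add]; congr 1; omega
  obtain ⟨r', rfl⟩ := Nat.exists_eq_add_of_le hp1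
  have hr'0 : r' ≠ 0 := by
    have := hodd p
    grind
  have hr'lt : r' < q ^ p := by
    by_contra! hcon
    have := Nat.mul_le_mul_right (q ^ (m - 1 - p)) (show 2 * q ^ p ≤ q ^ p + r' by omega)
    have h1 : 2 * q ^ p * q ^ (m - 1 - p) = 2 * q ^ (m - 1) := by rw [hpp]; ring
    omega
  set p' := Nat.log q r'
  have hp1' : q ^ p' ≤ r' := Nat.pow_log_le_self q hr'0
  have hp2' : r' < q ^ (p' + 1) := Nat.lt_pow_succ_log_self hq1 r'
  have hpp' : p' < p := hinj (by omega)
  have hrot' := h.rotation_le (by omega) hk (p := p') (x := r')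
    (y := q ^ (m - 2 - p') + q ^ (p - p' - 1)) (by omega) hp2' (by
      rw [mul_add, ← pow_add, ← pow_add, show p' + 1 + (m - 2 - p') = m - 1 by omega,
        show p' + 1 + (p - p' - 1) = p by omega]
      ring)
  have htop' : q ^ (m - 1) ≤ r' * q ^ (m - 1 - p') := by
    calc q ^ (m - 1) = q ^ p' * q ^ (m - 1 - p') := by rw [← pow_add]; congr 1; omega
      _ ≤ _ := Nat.mul_le_mul_right _ hp1'
  have hgap' : m - 2 - p' < p + 1 := hinj (by omega)
  have hgap : p' + (m - 1 - p) < p + 1 := hinj (by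
    have h1 := Nat.mul_le_mul_right (q ^ (m - 1 - p)) hp1'
    rw [← pow_add] at h1
    rw [add_mul, ← hpp] at hrot
    omega)
  have hpb : p = (2 * m - 1) / 3 := by
    refine le_antisymm ?_ (by omega)
    have h1 := hmono (show (m - 1) / 3 ≤ (2 * m - 1) / 3 by omega)
    have h2 := hthree ((2 * m - 1) / 3)
    have h3 : p < (2 * m - 1) / 3 + 1 := hinj (by omega)
    omega
  rw [← hpb] at hlt
  have hpc : p' < (m - 1) / 3 := hinj (by omega)
  rw [show m - 2 - p' = p by omega] at hrot'
  have hlast : p - p' - 1 < (m - 1) / 3 := hinj (by omega)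
  omega

theorem pow_add_pow_add_pow_le {q a b c u v w : ℕ} (hq : 3 ≤ q)
    (h : u < a ∧ v < a ∧ w < a ∨ u = a ∧ (v < b ∧ w < b ∨ v = b ∧ w ≤ c)) :
    q ^ u + q ^ v + q ^ w ≤ q ^ a + q ^ b + q ^ c := by
  have hmono : ∀ {u v : ℕ}, u ≤ v → q ^ u ≤ q ^ v := fun huv => Nat.pow_le_pow_right (by omega) huv
  have hthree : ∀ {u v : ℕ}, u < v → 3 * q ^ u ≤ q ^ v := fun {u v} huv => by
    refine le_trans ?_ (hmono huv)
    rw [Nat.pow_succ, mul_comm]; exact Nat.mul_le_mul_left _ hq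
  rcases h with ⟨h1, h2, h3⟩ | ⟨rfl, ⟨h1, h2⟩ | ⟨rfl, h1⟩⟩
  · have := hthree h1
    have := hthree h2
    have := hthree h3
    omega
  · have := hthree h1
    have := hthree h2
    omega
  · have := hmono h1
    omega

theorem pow_mul_pow_modEq {q m u j : ℕ} (hq : 0 < q) :
    q ^ u * q ^ j ≡ q ^ ((u + j) % m) [MOD q ^ m - 1] := by
  have h1 : q ^ m ≡ 1 [MOD q ^ m - 1] :=
    ((Nat.modEq_iff_dvd' (Nat.one_le_pow _ _ hq)).mpr dvd_rfl).symm
  have h2 := (h1.pow ((u + j) / m)).mul_left (q ^ ((u + j) % m))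
  rwa [one_pow, mul_one, ← pow_mul, ← pow_add, Nat.mod_add_div, pow_add] at h2

theorem rotated_exponents_le {q m : ℕ} (hq : 3 ≤ q) (hm : 2 ≤ m) (j : ℕ) :
    q ^ ((m - 1 + j) % m) + q ^ (((2 * m - 1) / 3 + j) % m) + q ^ (((m - 1) / 3 + j) % m)
      ≤ q ^ (m - 1) + q ^ ((2 * m - 1) / 3) + q ^ ((m - 1) / 3) := by
  have hmod : ∀ u, u < m → (u + j) % m = if u + j % m < m then u + j % m else u + j % m - m := by
    intro u hu
    have hj := Nat.mod_lt j (show 0 < m by omega)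
    rw [← Nat.add_mod_mod]
    split_ifs with h
    · exact Nat.mod_eq_of_lt h
    · rw [Nat.mod_eq_sub_mod (by omega), Nat.mod_eq_of_lt (by omega)]
  have hj := Nat.mod_lt j (show 0 < m by omega)
  rw [hmod _ (by omega), hmod _ (by omega), hmod _ (by omega)]
  set l := j % m
  rcases Nat.eq_zero_or_pos l with h0 | h0
  · rw [h0, if_pos (by omega), if_pos (by omega), if_pos (by omega)]; simp
  rw [if_neg (by omega)]
  by_cases hb : (2 * m - 1) / 3 + l = m - 1
  · rw [if_pos (by omega), if_pos (by omega)]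
    have := pow_add_pow_add_pow_le (q := q) (a := m - 1) (b := (2 * m - 1) / 3)
      (c := (m - 1) / 3) (u := (2 * m - 1) / 3 + l) (v := (m - 1) / 3 + l)
      (w := m - 1 + l - m) hq (by omega)
    omega
  by_cases hc : (m - 1) / 3 + l = m - 1
  · by_cases hm2 : m = 2
    · subst hm2
      have hl : l = 1 := by omega
      rw [hl]
      norm_num
      omega
    rw [if_neg (by omega), if_pos (by omega)]
    have := pow_add_pow_add_pow_le (q := q) (a := m - 1) (b := (2 * m - 1) / 3)
      (c := (m - 1) / 3) (u := (m - 1) / 3 + l) (v := m - 1 + l - m)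
      (w := (2 * m - 1) / 3 + l - m) hq (by omega)
    omega
  apply pow_add_pow_add_pow_le hq
  left
  split_ifs <;> omega

theorem stmt6 (q m : ℕ) (hq : Odd q) (hq3 : 3 ≤ q) (hpp : IsPrimePow q) (hm : 2 ≤ m)
    (δ2 : ℕ)
    (hδ2 : δ2 = (q - 1) * q ^ (m - 1) - q ^ ((2 * m - 1) / 3) - q ^ ((m - 1) / 3) - 1) :
    Odd δ2 ∧
    IsCosetLeader q (q ^ m - 1) δ2 ∧
    δ2 < (q - 1) * q ^ (m - 1) - 1 ∧
    ∀ i : ℕ, Odd i → IsCosetLeader q (q ^ m - 1) i →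
      i ≠ (q - 1) * q ^ (m - 1) - 1 → i ≤ δ2 := by
  have hmono : ∀ {u v : ℕ}, u ≤ v → q ^ u ≤ q ^ v := fun huv => Nat.pow_le_pow_right (by omega) huv
  have hpow : q ^ m = (q - 1) * q ^ (m - 1) + q ^ (m - 1) := by
    rw [← Nat.succ_mul, Nat.succ_eq_add_one, Nat.sub_add_cancel (by omega), ← pow_succ']
    congr 1; omega
  have htwo : 2 * q ^ (m - 1) ≤ (q - 1) * q ^ (m - 1) := Nat.mul_le_mul_right _ (by omega)
  have hb : q ^ ((2 * m - 1) / 3) ≤ q ^ (m - 1) := hmono (by omega)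
  have hc : q ^ ((m - 1) / 3) + 2 ≤ q ^ (m - 1) := by
    have h1 : q ^ ((m - 1) / 3) ≤ q ^ (m - 2) := hmono (by omega)
    have h2 : q ^ (m - 1) = q ^ (m - 2) * q := by rw [← pow_succ]; congr 1; omega
    have h3 := Nat.mul_le_mul_left (q ^ (m - 2)) hq3
    have h4 : 0 < q ^ (m - 2) := by positivity
    omega
  have hb0 : 0 < q ^ ((2 * m - 1) / 3) := by positivity
  have hodd : ∀ u, Odd (q ^ u) := fun u => hq.pow
  set k := q ^ (m - 1) + q ^ ((2 * m - 1) / 3) + q ^ ((m - 1) / 3) with hk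
  have hsum : δ2 + k = q ^ m - 1 := by omega
  have hkodd : Odd k := ((hodd _).add_odd (hodd _)).add_odd (hodd _)
  have hmodd := hodd m
  refine ⟨by grind, ⟨by omega, fun j => ?_⟩, by omega, fun i hi hlead hne => ?_⟩
  · have hR := rotated_exponents_le hq3 hm j
    have hR0 : 0 < q ^ ((m - 1 + j) % m) := by positivity
    set R := q ^ ((m - 1 + j) % m) + q ^ (((2 * m - 1) / 3 + j) % m)
      + q ^ (((m - 1) / 3 + j) % m) with hRdef
    have hmod : k * q ^ j ≡ R [MOD q ^ m - 1] := by
      rw [hk, add_mul, add_mul]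
      exact ((pow_mul_pow_modEq (by omega)).add (pow_mul_pow_modEq (by omega))).add
        (pow_mul_pow_modEq (by omega))
    have hdvd : q ^ m - 1 ∣ δ2 * q ^ j + R := by
      refine (Nat.ModEq.dvd_iff (hmod.add_left _) dvd_rfl).mp ?_
      rw [← add_mul, hsum]
      exact Dvd.intro _ rfl
    rw [mul_mod_eq_sub_of_dvd_add (by omega) (by omega) hdvd]
    omega
  · have hi' := hlead.1
    have hik : i + (q ^ m - 1 - i) = q ^ m - 1 := by omega
    have := complement_le_of_odd_leader hq hq3 hm hlead hik (by grind) (by omega)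
    omega
end

section
/- Let q ≥ 3 be an odd prime power, m ≥ 2, and δ2 = (q−1)q^{m−1} − q^{⌊(2m−1)/3⌋} − q^{⌊(m−1)/3⌋} − 1. Then the q-cyclotomic coset of δ2 modulo q^m − 1 has cardinality |C_{δ2}^{(q, q^m−1)}| = m if 3 ∤ m, and |C_{δ2}^{(q, q^m−1)}| = m/3 if 3 | m. -/
/-- The `q`-cyclotomic coset of `i` modulo `N`. -/
def cycCoset (q N i : ℕ) : Set ℕ := {a | ∃ j : ℕ, a = (i * q ^ j) % N}

/-- Digit sums in base `q` add over concatenation of digit blocks. -/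
theorem digits_sum_add_pow_mul {q : ℕ} (hq : 1 < q) (d : ℕ) :
    ∀ t r : ℕ, t < q ^ d →
      (Nat.digits q (t + q ^ d * r)).sum = (Nat.digits q t).sum + (Nat.digits q r).sum := by
  have step : ∀ n : ℕ, (Nat.digits q n).sum = n % q + (Nat.digits q (n / q)).sum := by
    intro n
    rcases Nat.eq_zero_or_pos n with rfl | hn
    · simp
    · rw [Nat.digits_def' hq hn, List.sum_cons]
  have hq0 : 0 < q := by omega
  induction d with
  | zero => intro t r ht; simp at ht; simp [ht]
  | succ d ih =>
    intro t r ht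
    have e : t + q ^ (d + 1) * r = t + q * (q ^ d * r) := by ring
    rw [step (t + q ^ (d + 1) * r), step t, e, Nat.add_mul_mod_self_left,
      Nat.add_mul_div_left _ _ hq0, ih (t / q) r, add_assoc]
    rw [Nat.div_lt_iff_lt_mul hq0, ← pow_succ]
    exact ht

theorem digits_sum_pow_mul {q : ℕ} (hq : 1 < q) (d r : ℕ) :
    (Nat.digits q (q ^ d * r)).sum = (Nat.digits q r).sum := by
  simpa using digits_sum_add_pow_mul hq d 0 r (pow_pos (by omega) d)

theorem digits_sum_of_lt {q c : ℕ} (hc : c < q) : (Nat.digits q c).sum = c := by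
  rcases Nat.eq_zero_or_pos c with rfl | h
  · simp
  · rw [Nat.digits_of_lt q c h.ne' hc]; simp

theorem digits_sum_pow {q : ℕ} (hq : 1 < q) (d : ℕ) : (Nat.digits q (q ^ d)).sum = 1 := by
  simpa [digits_sum_of_lt hq] using digits_sum_pow_mul hq d 1

theorem digits_sum_pow_add_pow_succ_mul {q : ℕ} (hq : 1 < q) (d r : ℕ) :
    (Nat.digits q (q ^ d + q ^ (d + 1) * r)).sum = 1 + (Nat.digits q r).sum := by
  rw [digits_sum_add_pow_mul hq (d + 1) _ r (Nat.pow_lt_pow_succ hq), digits_sum_pow hq]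

/-- The digit sum of a block `t` of length `g` repeated `e` times. -/
theorem digits_sum_geom_mul {q : ℕ} (hq : 1 < q) (g t : ℕ) (ht : t < q ^ g) (e : ℕ) :
    (Nat.digits q ((∑ i ∈ Finset.range e, (q ^ g) ^ i) * t)).sum
      = e * (Nat.digits q t).sum := by
  induction e with
  | zero => simp
  | succ e ih =>
    have h : (∑ i ∈ Finset.range (e + 1), (q ^ g) ^ i) * t
        = t + q ^ g * ((∑ i ∈ Finset.range e, (q ^ g) ^ i) * t) := by
      rw [Finset.sum_range_succ', add_mul, ← mul_assoc, Finset.mul_sum]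
      simp only [pow_succ', pow_zero, one_mul]
      ring
    rw [h, digits_sum_add_pow_mul hq g t _ ht, ih]
    ring

/-- If multiplication by `q ^ d` fixes `s` modulo `q ^ m - 1`, then `m` divides `d` times the
digit sum of `s`. -/
theorem dvd_digits_sum_mul_of_dvd {q m s d : ℕ} (hq : 1 < q) (hm : 0 < m) (hs : s < q ^ m)
    (h : q ^ m - 1 ∣ s * (q ^ d - 1)) : m ∣ (Nat.digits q s).sum * d := by
  have hg0 : 0 < Nat.gcd d m := Nat.gcd_pos_of_pos_right _ hm
  have hN : q ^ m - 1 ∣ s * (q ^ Nat.gcd d m - 1) := by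
    rw [← Nat.pow_sub_one_gcd_pow_sub_one, ← Nat.gcd_mul_left]
    exact Nat.dvd_gcd h (Dvd.intro_left _ rfl)
  have hgd : Nat.gcd d m ∣ d := Nat.gcd_dvd_left d m
  obtain ⟨e, he⟩ := Nat.gcd_dvd_right d m
  generalize Nat.gcd d m = g at *
  subst he
  have hQ : 1 < q ^ g := Nat.one_lt_pow hg0.ne' hq
  have hgeom : (∑ i ∈ Finset.range e, (q ^ g) ^ i) * (q ^ g - 1) = q ^ (g * e) - 1 := by
    rw [pow_mul]
    exact geom_sum_mul_of_one_le hQ.le e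
  rw [← hgeom] at hN
  obtain ⟨t, rfl⟩ := Nat.dvd_of_mul_dvd_mul_right (by omega) hN
  have hM : 0 < ∑ i ∈ Finset.range e, (q ^ g) ^ i := by
    rcases Nat.eq_zero_or_pos (∑ i ∈ Finset.range e, (q ^ g) ^ i) with h0 | h0
    · have := Nat.one_lt_pow hm.ne' hq
      rw [h0] at hgeom
      omega
    · exact h0
  have ht : t < q ^ g := by
    have : (∑ i ∈ Finset.range e, (q ^ g) ^ i) * t
        ≤ (∑ i ∈ Finset.range e, (q ^ g) ^ i) * (q ^ g - 1) := by omega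
    have := Nat.le_of_mul_le_mul_left this hM
    omega
  rw [digits_sum_geom_mul hq g t ht e]
  obtain ⟨k, rfl⟩ := hgd
  exact ⟨(Nat.digits q t).sum * k, by ring⟩

/-- The size of a cyclotomic coset is the least positive `p` with `i * q ^ p ≡ i`. -/
theorem ncard_cycCoset {q N i p : ℕ} (hq : 0 < q) (hqN : Nat.Coprime N q) (hp : 0 < p)
    (hper : N ∣ i * (q ^ p - 1)) (hmin : ∀ d, 0 < d → d < p → ¬ N ∣ i * (q ^ d - 1)) :
    (cycCoset q N i).ncard = p := by
  have himg : cycCoset q N i = (fun j => (i * q ^ j) % N) '' (Finset.range p : Set ℕ) := by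
    have hmod : i * q ^ p ≡ i [MOD N] := by
      refine ((Nat.modEq_iff_dvd' (Nat.le_mul_of_pos_right _ (pow_pos hq p))).2 ?_).symm
      rwa [Nat.mul_sub, mul_one] at hper
    have hmul : ∀ k r, i * q ^ (r + p * k) ≡ i * q ^ r [MOD N] := by
      intro k r
      induction k with
      | zero => simp [Nat.ModEq.refl]
      | succ k ih =>
        have h := hmod.mul_right (q ^ (r + p * k))
        have e : i * q ^ (r + p * (k + 1)) = i * q ^ p * q ^ (r + p * k) := by ring
        rw [e]
        exact h.trans ih
    ext a
    constructor
    · rintro ⟨j, rfl⟩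
      refine ⟨j % p, by simpa using Nat.mod_lt j hp, ?_⟩
      have := hmul (j / p) (j % p)
      rw [Nat.mod_add_div] at this
      exact this.symm
    · rintro ⟨j, -, rfl⟩
      exact ⟨j, rfl⟩
  have hne : ∀ a b, a < b → b < p → (i * q ^ a) % N ≠ (i * q ^ b) % N := by
    intro a b hab hb h
    have hle : i * q ^ a ≤ i * q ^ b := Nat.mul_le_mul_left _ (Nat.pow_le_pow_right hq hab.le)
    have hdvd := (Nat.modEq_iff_dvd' hle).1 h
    have e : i * q ^ b - i * q ^ a = q ^ a * (i * (q ^ (b - a) - 1)) := by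
      have : q ^ b = q ^ a * q ^ (b - a) := by rw [← pow_add]; congr 1; omega
      rw [this, Nat.mul_sub, Nat.mul_sub]
      congr 1 <;> ring
    rw [e] at hdvd
    exact hmin (b - a) (by omega) (by omega) ((hqN.pow_right a).dvd_of_dvd_mul_left hdvd)
  rw [himg, Set.InjOn.ncard_image, Set.ncard_coe_finset, Finset.card_range]
  intro a ha b hb h
  simp only [Finset.coe_range, Set.mem_Iio] at ha hb
  rcases lt_trichotomy a b with hab | hab | hab
  · exact absurd h (hne a b hab hb)
  · exact hab
  · exact absurd h.symm (hne b a hab ha)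

theorem stmt7 (q m : ℕ) (hq : Odd q) (hq3 : 3 ≤ q) (hpp : IsPrimePow q) (hm : 2 ≤ m)
    (δ2 : ℕ)
    (hδ2 : δ2 = (q - 1) * q ^ (m - 1) - q ^ ((2 * m - 1) / 3) - q ^ ((m - 1) / 3) - 1) :
    (¬ (3 ∣ m) → (cycCoset q (q ^ m - 1) δ2).ncard = m) ∧
    (3 ∣ m → (cycCoset q (q ^ m - 1) δ2).ncard = m / 3) := by
  have hq1 : 1 < q := by omega
  obtain ⟨s, hs⟩ : ∃ s, s = q ^ (m - 1) + q ^ ((2 * m - 1) / 3) + q ^ ((m - 1) / 3) := ⟨_, rfl⟩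
  have hpow : q ^ m = q * q ^ (m - 1) := by rw [← pow_succ']; congr 1; omega
  have hslt : s < q ^ m := by
    have h1 : q ^ ((2 * m - 1) / 3) ≤ q ^ (m - 1) := Nat.pow_le_pow_right (by omega) (by omega)
    have h2 : q ^ ((m - 1) / 3) < q ^ (m - 1) := Nat.pow_lt_pow_right hq1 (by omega)
    have h3 : 3 * q ^ (m - 1) ≤ q * q ^ (m - 1) := Nat.mul_le_mul_right _ hq3
    omega
  have hsum : δ2 + s = q ^ m - 1 := by
    rw [Nat.sub_mul, one_mul] at hδ2
    omega
  have hdig : (Nat.digits q s).sum = 3 := by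
    rcases Nat.lt_or_ge m 3 with h | h
    · obtain rfl : m = 2 := by omega
      have e : s = q ^ 0 + q ^ (0 + 1) * 2 := by rw [hs]; norm_num; ring
      rw [e, digits_sum_pow_add_pow_succ_mul hq1, digits_sum_of_lt (by omega)]
    · obtain ⟨b, hb⟩ : ∃ b, b = (m - 1) / 3 := ⟨_, rfl⟩
      obtain ⟨u, hu⟩ : ∃ u, (2 * m - 1) / 3 = b + 1 + u :=
        ⟨(2 * m - 1) / 3 - (b + 1), by omega⟩
      obtain ⟨v, hv⟩ : ∃ v, m - 1 = b + 1 + (u + 1) + v :=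
        ⟨m - 1 - (b + 1 + (u + 1)), by omega⟩
      have e : s = q ^ b + q ^ (b + 1) * (q ^ u + q ^ (u + 1) * q ^ v) := by
        rw [hs, ← hb, hu, hv]; ring
      rw [e, digits_sum_pow_add_pow_succ_mul hq1, digits_sum_pow_add_pow_succ_mul hq1,
        digits_sum_pow hq1]
  have hiff : ∀ d, q ^ m - 1 ∣ δ2 * (q ^ d - 1) ↔ q ^ m - 1 ∣ s * (q ^ d - 1) := by
    intro d
    have h : q ^ m - 1 ∣ δ2 * (q ^ d - 1) + s * (q ^ d - 1) := by
      rw [← add_mul, hsum]; exact Dvd.intro _ rfl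
    exact ⟨fun h' => (Nat.dvd_add_right h').1 h, fun h' => (Nat.dvd_add_left h').1 h⟩
  have hper : ∀ d, q ^ m - 1 ∣ δ2 * (q ^ d - 1) → m ∣ 3 * d := by
    intro d h
    rw [← hdig]
    exact dvd_digits_sum_mul_of_dvd hq1 (by omega) hslt ((hiff d).1 h)
  have hcop : Nat.Coprime (q ^ m - 1) q := by
    have h : Nat.Coprime (q ^ m - 1) (q ^ m) :=
      (Nat.coprime_self_sub_left (Nat.one_le_pow _ _ (by omega))).2 (Nat.coprime_one_left _)
    exact h.coprime_dvd_right (dvd_pow_self q (by omega))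
  constructor
  · intro h3
    refine ncard_cycCoset (by omega) hcop (by omega) (Dvd.intro_left _ rfl) ?_
    intro d hd0 hd h
    have hc : Nat.Coprime m 3 := ((Nat.Prime.coprime_iff_not_dvd Nat.prime_three).2 h3).symm
    have := Nat.le_of_dvd hd0 (hc.dvd_of_dvd_mul_left (hper d h))
    omega
  · rintro ⟨k, rfl⟩
    rw [Nat.mul_div_cancel_left _ (by norm_num)]
    refine ncard_cycCoset (by omega) hcop (by omega) ((hiff k).2 ?_) ?_
    · refine ⟨q ^ (k - 1), ?_⟩
      have e : s = q ^ (k - 1) * (1 + q ^ k + (q ^ k) ^ 2) := by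
        rw [hs, show (3 * k - 1) / 3 = k - 1 by omega,
          show 3 * k - 1 = k - 1 + k * 2 by omega,
          show (2 * (3 * k) - 1) / 3 = k - 1 + k by omega, pow_add, pow_add, pow_mul]
        ring
      rw [e, mul_comm 3 k, pow_mul]
      obtain ⟨x, hx⟩ : ∃ x, q ^ k = x + 1 :=
        ⟨q ^ k - 1, by have := Nat.one_le_pow k q (by omega); omega⟩
      rw [hx, show (x + 1) ^ 3 - 1 = x ^ 3 + 3 * x ^ 2 + 3 * x by
        rw [show (x + 1) ^ 3 = x ^ 3 + 3 * x ^ 2 + 3 * x + 1 by ring]; rfl, Nat.add_sub_cancel]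
      ring
    · intro d hd0 hd h
      have := Nat.le_of_dvd (by omega) (hper d h)
      omega
end

section
/- Let q ≥ 3 be an odd prime power and m ≥ 2 with q^m ≥ 25. Define δ3 = (q−1)q^{m−1} − q^{⌈(2m−1)/3⌉} − q^{⌊m/3 − 1⌋} − 1 if 3 ∤ (m+1), and δ3 = (q−1)q^{m−1} − q^{(2m−1)/3} − q^{(m+1)/3} − 1 if 3 | (m+1). Then δ3 is the third largest odd coset leader modulo q^m − 1: δ3 is odd, δ3 is a coset leader modulo q^m − 1, δ3 is smaller than the two largest odd coset leaders δ1 = (q−1)q^{m−1} − 1 and δ2 = (q−1)q^{m−1} − q^{⌊(2m−1)/3⌋} − q^{⌊(m−1)/3⌋} − 1, and every odd coset leader modulo q^m − 1 other than δ1 and δ2 is at most δ3. Moreover |C_{δ3}^{(q, q^m−1)}| = m. -/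
/-- `b` is at least as large as each of its cyclic shifts as an `m`-digit word in base `q`. -/
def IsRotMax (q m b : ℕ) : Prop :=
  ∀ s ≤ m, ∀ A B : ℕ, B < q ^ s → b = A * q ^ s + B → B * q ^ (m - s) + A ≤ b

lemma compl_mul_pow_mod {q m s b A B : ℕ} (hs : s ≤ m) (hb0 : 0 < b) (hb : b < q ^ m)
    (hB : B < q ^ s) (h : b = A * q ^ s + B) :
    ((q ^ m - 1 - b) * q ^ (m - s)) % (q ^ m - 1) = q ^ m - 1 - (B * q ^ (m - s) + A) ∧
      B * q ^ (m - s) + A ≤ q ^ m - 1 := by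
  have hsplit : q ^ m = q ^ s * q ^ (m - s) := by rw [← pow_add]; congr 1; omega
  have hA : A < q ^ (m - s) := by
    by_contra! hA
    have := Nat.mul_le_mul_right (q ^ s) hA
    nlinarith
  have hy : B * q ^ (m - s) + A < q ^ m := by
    have := Nat.mul_le_mul_right (q ^ (m - s)) (Nat.succ_le_of_lt hB)
    rw [hsplit]
    simp only [Nat.succ_eq_add_one, add_mul] at this
    omega
  have hQ : 0 < q ^ (m - s) := by omega
  have hy0 : 0 < B * q ^ (m - s) + A := by
    rcases Nat.eq_zero_or_pos A with rfl | hA0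
    · have : 0 < B := by simpa [h] using hb0
      positivity
    · omega
  refine ⟨?_, by omega⟩
  obtain ⟨N, hN⟩ : ∃ N, q ^ m = N + 1 := ⟨q ^ m - 1, by omega⟩
  obtain ⟨D, hD⟩ : ∃ D, q ^ (m - s) = A + 1 + D := ⟨q ^ (m - s) - (A + 1), by omega⟩
  obtain ⟨i, hi⟩ : ∃ i, N = b + i := ⟨N - b, by omega⟩
  obtain ⟨z, hz⟩ : ∃ z, N = (B * q ^ (m - s) + A) + z := ⟨N - (B * q ^ (m - s) + A), by omega⟩
  have e1 : q ^ m - 1 = N := by omega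
  have e2 : N - b = i := by omega
  have e3 : N - (B * q ^ (m - s) + A) = z := by omega
  rw [e1, e2, e3]
  have key : i * q ^ (m - s) = z + N * D := by
    have h1 : b * q ^ (m - s) = A * q ^ m + B * q ^ (m - s) := by rw [h, hsplit]; ring
    have h2 : N * q ^ (m - s) = b * q ^ (m - s) + i * q ^ (m - s) := by
      rw [← add_mul, ← hi]
    have h3 : N * q ^ (m - s) = N * A + N + N * D := by rw [hD]; ring
    have h4 : A * q ^ m = N * A + A := by rw [hN]; ring
    omega
  rw [key, Nat.add_mul_mod_self_left, Nat.mod_eq_of_lt (by omega)]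

lemma IsCosetLeader.isRotMax {q m i : ℕ} (hi : IsCosetLeader q (q ^ m - 1) i) (hi0 : 0 < i) :
    IsRotMax q m (q ^ m - 1 - i) := by
  intro s hs A B hB h
  obtain ⟨h1, h2⟩ := hi
  obtain ⟨h3, h4⟩ := compl_mul_pow_mod hs (by omega) (by omega) hB h
  have h5 := h2 (m - s)
  rw [show q ^ m - 1 - (q ^ m - 1 - i) = i by omega] at h3
  rw [h3] at h5
  omega

/-- Fewer than three copies of `q ^ t` bound the exponent as well, since `3 ≤ q`. -/
lemma le_of_pow_lt_three_mul {q a t : ℕ} (hq : 3 ≤ q) (h : q ^ a < 3 * q ^ t) : a ≤ t := by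
  by_contra! hc
  have h1 : q ^ (t + 1) ≤ q ^ a := Nat.pow_le_pow_right (by omega) hc
  rw [pow_succ] at h1
  have := Nat.mul_le_mul_left (q ^ t) hq
  omega

lemma three_mul_pow_le {q a t : ℕ} (hq : 3 ≤ q) (h : a < t) : 3 * q ^ a ≤ q ^ t := by
  by_contra! hc
  exact absurd (le_of_pow_lt_three_mul hq hc) (by omega)

lemma IsRotMax.exists_leading {q m s b A B : ℕ} (hq : 3 ≤ q) (h : IsRotMax q m b)
    (hb : b < 2 * q ^ (m - 1)) (hs : s ≤ m) (hB : B < q ^ s) (hB0 : B ≠ 0)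
    (hbB : b = A * q ^ s + B) :
    ∃ t < s, ∃ r < q ^ t, B = q ^ t + r := by
  have hlt := Nat.lt_pow_succ_log_self (b := q) (by omega) B
  have hle := Nat.pow_log_le_self q hB0
  set t := Nat.log q B with ht
  have hts : t < s := (Nat.pow_lt_pow_iff_right (by omega : 1 < q)).1 (hle.trans_lt hB)
  refine ⟨t, hts, B - q ^ t, ?_, by omega⟩
  have h1 := h (t + 1) (by omega) (A * q ^ (s - (t + 1))) B hlt (by
    rw [mul_assoc, ← pow_add, hbB]; congr 3; omega)
  have h2 : q ^ (m - 1) = q ^ t * q ^ (m - (t + 1)) := by rw [← pow_add]; congr 1; omega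
  have h3 : B < 2 * q ^ t := by
    by_contra! hc
    have := Nat.mul_le_mul_right (q ^ (m - (t + 1))) hc
    rw [mul_assoc, ← h2] at this
    omega
  omega

lemma IsRotMax.eq_pow_or_exists {q m b : ℕ} (hq : 3 ≤ q) (hqo : Odd q) (hm : 3 ≤ m)
    (h : IsRotMax q m b) (hb0 : 0 < b) (hb : b < 2 * q ^ (m - 1)) (hbo : Odd b) :
    b = q ^ (m - 1) ∨ ∃ t u r, u < t ∧ t < m - 1 ∧ b = q ^ (m - 1) + q ^ t + q ^ u + r ∧
      m - 1 + u ≤ 2 * t ∧ m - 2 ≤ t + u ∧ (m - 2 = t + u → t ≤ 2 * u + 1) ∧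
      (r ≠ 0 → m ≤ t + u) := by
  have hpo : ∀ n, q ^ n % 2 = 1 := fun n => Nat.odd_iff.1 hqo.pow
  have hp0 : ∀ n, 0 < q ^ n := fun n => Nat.pow_pos (by omega)
  have hbm : b < q ^ m := by
    have : 3 * q ^ (m - 1) ≤ q ^ m := three_mul_pow_le hq (by omega)
    omega
  have hbo' := Nat.odd_iff.1 hbo
  obtain ⟨w, hw, c, hc, rfl⟩ := h.exists_leading hq hb le_rfl hbm hb0.ne' (A := 0) (by simp)
  obtain rfl : w = m - 1 := by
    by_contra hne
    have h1 := h (w + 1) (by omega) 0 (q ^ w + c) (by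
      have := three_mul_pow_le hq (Nat.lt_succ_self w)
      simp only [Nat.succ_eq_add_one] at this
      omega) (by simp)
    have h2 : 3 * q ^ 0 ≤ q ^ (m - (w + 1)) := three_mul_pow_le hq (by omega)
    nlinarith [hp0 w]
  rcases Nat.eq_zero_or_pos c with rfl | hc0
  · simp
  right
  obtain ⟨t, ht, d, hd, rfl⟩ := h.exists_leading hq hb (by omega) hc hc0.ne' (A := 1) (by ring)
  have hd0 : d ≠ 0 := by
    rintro rfl
    have := hpo (m - 1); have := hpo t; omega
  obtain ⟨u, hu, r, hr, rfl⟩ := h.exists_leading hq hb (by omega) hd hd0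
    (A := q ^ (m - 1 - t) + 1) (by rw [add_mul, ← pow_add, Nat.sub_add_cancel (by omega)]; ring)
  have hre : r % 2 = 0 := by
    have := hpo (m - 1); have := hpo t; have := hpo u; omega
  have hut := three_mul_pow_le hq hu
  have htt : 3 * q ^ t ≤ q ^ (t + 1) := three_mul_pow_le hq (by omega)
  have huu : 3 * q ^ u ≤ q ^ (u + 1) := three_mul_pow_le hq (by omega)
  -- the shift bringing the digit at `t` to the front
  have R1 := h (t + 1) (by omega) (q ^ (m - 2 - t)) (q ^ t + (q ^ u + r)) (by omega) (by
    rw [← pow_add, show m - 2 - t + (t + 1) = m - 1 by omega])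
  -- the shift bringing the digit at `u` to the front
  have R2 := h (u + 1) (by omega) (q ^ (m - 2 - u) + q ^ (t - u - 1)) (q ^ u + r) (by omega) (by
    rw [add_mul, ← pow_add, ← pow_add, show m - 2 - u + (u + 1) = m - 1 by omega,
      show t - u - 1 + (u + 1) = t by omega]; ring)
  simp only [add_mul, ← pow_add] at R1 R2
  rw [show t + (m - (t + 1)) = m - 1 by omega] at R1
  rw [show u + (m - (u + 1)) = m - 1 by omega] at R2
  have hr2 : r ≤ r * q ^ (m - (u + 1)) := Nat.le_mul_of_pos_right _ (hp0 _)
  refine ⟨t, u, r, hu, ht, by ring, ?_, ?_, ?_, ?_⟩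
  · have : u + (m - (t + 1)) ≤ t := le_of_pow_lt_three_mul hq (by omega)
    omega
  · have : m - 2 - u ≤ t := le_of_pow_lt_three_mul hq (by omega)
    omega
  · intro he
    rw [show m - 2 - u = t by omega] at R2
    have : t - u - 1 ≤ u := le_of_pow_lt_three_mul hq (by omega)
    omega
  · intro hr0
    by_contra! hc
    have h1 : q ^ t ≤ q ^ (m - (u + 1)) := Nat.pow_le_pow_right (by omega) (by omega)
    have h2 := Nat.mul_le_mul (show 2 ≤ r by omega) h1
    omega

lemma isCosetLeader_and_ncard_cycCoset {q m b : ℕ} (hb0 : 0 < b) (hb : b < q ^ m - 1)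
    (h : ∀ s, 0 < s → s < m → ∃ A B, B < q ^ s ∧ b = A * q ^ s + B ∧ B * q ^ (m - s) + A < b) :
    IsCosetLeader q (q ^ m - 1) (q ^ m - 1 - b) ∧
      (cycCoset q (q ^ m - 1) (q ^ m - 1 - b)).ncard = m := by
  set N := q ^ m - 1 with hN
  have hm : 0 < m := by
    rcases Nat.eq_zero_or_pos m with rfl | h0
    · simp at hN; omega
    · exact h0
  have hqm : q ^ m ≡ 1 [MOD N] := by
    rw [show q ^ m = N + 1 by omega]
    simp [Nat.ModEq]
  have hper : ∀ a j, (a * q ^ j) % N = (a * q ^ (j % m)) % N := by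
    intro a j
    conv_lhs => rw [← Nat.div_add_mod j m, pow_add, pow_mul]
    have := ((hqm.pow (j / m)).mul_right (q ^ (j % m))).mul_left a
    simpa [Nat.ModEq] using this
  have hlt : ∀ j, 0 < j → j < m → N - b < ((N - b) * q ^ j) % N := by
    intro j hj0 hjm
    obtain ⟨A, B, hB, hbe, hy⟩ := h (m - j) (by omega) (by omega)
    have := (compl_mul_pow_mod (Nat.sub_le m j) hb0 (by omega) hB hbe).1
    rw [Nat.sub_sub_self hjm.le] at this hy
    rw [this]
    omega
  have h0 : (N - b) % N = N - b := Nat.mod_eq_of_lt (by omega)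
  refine ⟨⟨by omega, fun j => ?_⟩, ?_⟩
  · rw [hper]
    rcases Nat.eq_zero_or_pos (j % m) with hj | hj
    · simp [hj, h0]
    · exact (hlt _ hj (Nat.mod_lt _ hm)).le
  · have hset : cycCoset q N (N - b) = (fun j => ((N - b) * q ^ j) % N) '' Set.Iio m := by
      ext a
      constructor
      · rintro ⟨j, rfl⟩
        exact ⟨j % m, Nat.mod_lt _ hm, (hper _ _).symm⟩
      · rintro ⟨j, -, rfl⟩
        exact ⟨j, rfl⟩
    have hne : ∀ j k, j < k → k < m → ((N - b) * q ^ j) % N ≠ ((N - b) * q ^ k) % N := by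
      intro j k hjk hkm he
      have h1 : ((N - b) * q ^ j) * q ^ (m - k) ≡ ((N - b) * q ^ k) * q ^ (m - k) [MOD N] :=
        Nat.ModEq.mul_right _ he
      rw [mul_assoc, mul_assoc, ← pow_add, ← pow_add, Nat.add_sub_cancel' hkm.le] at h1
      have h2 : (N - b) * q ^ m ≡ N - b [MOD N] := by simpa using hqm.mul_left (N - b)
      have h3 := h1.trans h2
      have h4 := hlt (j + (m - k)) (by omega) (by omega)
      rw [Nat.ModEq, h0] at h3
      omega
    rw [hset, Set.InjOn.ncard_image, ← Finset.coe_Iio, Set.ncard_coe_finset, Nat.card_Iio]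
    intro j hj k hk he
    rcases lt_trichotomy j k with hjk | hjk | hjk
    · exact absurd he (hne j k hjk hk)
    · exact hjk
    · exact absurd he.symm (hne k j hjk hj)

lemma exists_rotation_lt {q m e f : ℕ} (hq : 3 ≤ q) (hfe : f < e) (hem : e < m)
    (h1 : m < e + f + 2) (h2 : f + m < 2 * e + 1 ∨ f + m = 2 * e + 1 ∧ m - 2 - e < f)
    {s : ℕ} (hs0 : 0 < s) (hs : s < m) :
    ∃ A B, B < q ^ s ∧ q ^ (m - 1) + q ^ e + q ^ f = A * q ^ s + B ∧
      B * q ^ (m - s) + A < q ^ (m - 1) + q ^ e + q ^ f := by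
  have hp0 : ∀ n, 0 < q ^ n := fun n => Nat.pow_pos (by omega)
  have hmono : ∀ {a c}, a ≤ c → q ^ a ≤ q ^ c := fun h => Nat.pow_le_pow_right (by omega) h
  have hm2 : 3 * q ^ (m - 2) ≤ q ^ (m - 1) := three_mul_pow_le hq (by omega)
  have he0 := hp0 e
  have hf0 := hp0 f
  have hsplit : ∀ {a}, s ≤ a → q ^ (a - s) * q ^ s = q ^ a := fun h => by
    rw [← pow_add, Nat.sub_add_cancel h]
  rcases le_or_gt s f with hsf | hsf
  · refine ⟨q ^ (m - 1 - s) + q ^ (e - s) + q ^ (f - s), 0, hp0 s, ?_, ?_⟩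
    · rw [add_mul, add_mul, hsplit (by omega), hsplit (by omega), hsplit hsf, add_zero]
    · have : 3 * q ^ (m - 1 - s) ≤ q ^ (m - 1) := three_mul_pow_le hq (by omega)
      have : q ^ (e - s) ≤ q ^ (m - 1 - s) := hmono (by omega)
      have : q ^ (f - s) ≤ q ^ (m - 1 - s) := hmono (by omega)
      omega
  have hfs := three_mul_pow_le hq hsf
  rcases le_or_gt s e with hse | hse
  · refine ⟨q ^ (m - 1 - s) + q ^ (e - s), q ^ f, by omega, ?_, ?_⟩
    · rw [add_mul, hsplit (by omega), hsplit hse]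
    rw [← pow_add]
    have hes : q ^ (e - s) ≤ q ^ (m - 1 - s) := hmono (by omega)
    rcases Nat.eq_or_lt_of_le (show f + 1 ≤ s from hsf) with hs1 | hs1
    · rw [show f + (m - s) = m - 1 by omega]
      have : 3 * q ^ (m - 1 - s) ≤ q ^ e := three_mul_pow_le hq (by omega)
      omega
    · have : q ^ (f + (m - s)) ≤ q ^ (m - 2) := hmono (by omega)
      have : q ^ (m - 1 - s) ≤ q ^ (m - 2) := hmono (by omega)
      omega
  · have hes := three_mul_pow_le hq hse
    have hfe' := three_mul_pow_le hq hfe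
    refine ⟨q ^ (m - 1 - s), q ^ e + q ^ f, by omega, ?_, ?_⟩
    · rw [hsplit (by omega), add_assoc]
    rw [add_mul, ← pow_add, ← pow_add]
    rcases Nat.eq_or_lt_of_le (show e + 1 ≤ s from hse) with hs1 | hs1
    · rw [show e + (m - s) = m - 1 by omega]
      rcases h2 with h2 | ⟨h2, h3⟩
      · have : 3 * q ^ (f + (m - s)) ≤ q ^ e := three_mul_pow_le hq (by omega)
        have : q ^ (m - 1 - s) ≤ q ^ (f + (m - s)) := hmono (by omega)
        omega
      · rw [show f + (m - s) = e by omega]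
        have : 3 * q ^ (m - 1 - s) ≤ q ^ f := three_mul_pow_le hq (by omega)
        omega
    · have : q ^ (e + (m - s)) ≤ q ^ (m - 2) := hmono (by omega)
      have : q ^ (f + (m - s)) ≤ q ^ (m - 2) := hmono (by omega)
      have : q ^ (m - 1 - s) ≤ q ^ (m - 2) := hmono (by omega)
      omega

lemma le_of_isRotMax_of_odd {q m b e f e' f' : ℕ} (hq : 3 ≤ q) (hqo : Odd q) (hm : 3 ≤ m)
    (he' : e' = (2 * m - 1) / 3) (hf' : f' = (m - 1) / 3)
    (hef : ¬ 3 ∣ m + 1 ∧ e = (2 * m + 1) / 3 ∧ f = m / 3 - 1 ∨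
      3 ∣ m + 1 ∧ e = (2 * m - 1) / 3 ∧ f = (m + 1) / 3)
    (h : IsRotMax q m b) (hb0 : 0 < b) (hbo : Odd b) (h1 : b ≠ q ^ (m - 1))
    (h2 : b ≠ q ^ (m - 1) + q ^ e' + q ^ f') : q ^ (m - 1) + q ^ e + q ^ f ≤ b := by
  by_contra! hlt
  have hmono : ∀ {a c}, a ≤ c → q ^ a ≤ q ^ c := fun h => Nat.pow_le_pow_right (by omega) h
  have hb2 : b < 2 * q ^ (m - 1) := by
    rcases Nat.lt_or_ge e (m - 1) with he | he
    · have : 3 * q ^ e ≤ q ^ (m - 1) := three_mul_pow_le hq he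
      have : q ^ f ≤ q ^ e := hmono (by omega)
      omega
    · obtain rfl : e = m - 1 := by omega
      obtain rfl : f = 0 := by omega
      have := Nat.odd_iff.1 hbo
      simp only [pow_zero] at hlt
      omega
  obtain h0 | ⟨t, u, r, hut, htm, rfl, F1, F2, F3, F4⟩ := h.eq_pow_or_exists hq hqo hm hb0 hb2 hbo
  · exact h1 h0
  have F5 : t < e ∨ t = e ∧ u < f := by
    by_contra! hc
    rcases Nat.lt_or_ge e t with het | het
    · have := three_mul_pow_le hq het
      have : q ^ f ≤ q ^ e := hmono (by omega)
      omega
    · obtain rfl : t = e := by omega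
      have : q ^ f ≤ q ^ u := hmono (by omega)
      omega
  have hr : r = 0 := by
    by_contra hr
    have := F4 hr
    omega
  have ht : t = e' := by omega
  have hu : u = f' := by omega
  exact h2 (by rw [hr, ht, hu, add_zero])

lemma le_of_isRotMax_two {q b : ℕ} (hq : 3 ≤ q) (hqo : Odd q) (h : IsRotMax q 2 b)
    (hb0 : 0 < b) (hbo : Odd b) (h1 : b ≠ q) (h2 : b ≠ 2 * q + 1) : 3 * q ≤ b := by
  by_contra! hlt
  have hr := Nat.mod_lt b (show q > 0 by omega)
  have hdm := Nat.div_add_mod' b q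
  have hd : b / q < 3 := Nat.div_lt_of_lt_mul (by omega)
  have R := h 1 (by omega) (b / q) (b % q) (by simpa using hr) (by simpa using hdm.symm)
  simp only [show 2 - 1 = 1 by omega, pow_one] at R
  have hle : b % q ≤ b / q := by
    by_contra! hc
    obtain ⟨x, hx⟩ := Nat.exists_eq_add_of_lt hc
    rw [hx] at R hdm
    nlinarith
  have hb' := Nat.odd_iff.1 hbo
  have hq' := Nat.odd_iff.1 hqo
  generalize b / q = d at *
  interval_cases d <;> omega

theorem stmt8 (q m : ℕ) (hq : Odd q) (hq3 : 3 ≤ q) (hpp : IsPrimePow q) (hm : 2 ≤ m)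
    (hqm : 25 ≤ q ^ m)
    (δ1 δ2 δ3 : ℕ)
    (hδ1 : δ1 = (q - 1) * q ^ (m - 1) - 1)
    (hδ2 : δ2 = (q - 1) * q ^ (m - 1) - q ^ ((2 * m - 1) / 3) - q ^ ((m - 1) / 3) - 1)
    (hδ3a : ¬ (3 ∣ (m + 1)) →
      δ3 = (q - 1) * q ^ (m - 1) - q ^ ((2 * m + 1) / 3) - q ^ (m / 3 - 1) - 1)
    (hδ3b : 3 ∣ (m + 1) →
      δ3 = (q - 1) * q ^ (m - 1) - q ^ ((2 * m - 1) / 3) - q ^ ((m + 1) / 3) - 1) :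
    Odd δ3 ∧
    IsCosetLeader q (q ^ m - 1) δ3 ∧
    δ3 < δ2 ∧ δ3 < δ1 ∧
    (∀ i : ℕ, Odd i → IsCosetLeader q (q ^ m - 1) i → i ≠ δ1 → i ≠ δ2 → i ≤ δ3) ∧
    (cycCoset q (q ^ m - 1) δ3).ncard = m := by
  have hpo : ∀ n, q ^ n % 2 = 1 := fun n => Nat.odd_iff.1 hq.pow
  have hp0 : ∀ n, 0 < q ^ n := fun n => Nat.pow_pos (by omega)
  obtain ⟨e', he'⟩ : ∃ e', e' = (2 * m - 1) / 3 := ⟨_, rfl⟩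
  obtain ⟨f', hf'⟩ : ∃ f', f' = (m - 1) / 3 := ⟨_, rfl⟩
  obtain ⟨e, f, hef⟩ : ∃ e f, ¬ 3 ∣ m + 1 ∧ e = (2 * m + 1) / 3 ∧ f = m / 3 - 1 ∨
      3 ∣ m + 1 ∧ e = (2 * m - 1) / 3 ∧ f = (m + 1) / 3 := by
    by_cases h : 3 ∣ m + 1
    · exact ⟨_, _, .inr ⟨h, rfl, rfl⟩⟩
    · exact ⟨_, _, .inl ⟨h, rfl, rfl⟩⟩
  have hqY : (q - 1) * q ^ (m - 1) = q ^ m - q ^ (m - 1) := by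
    rw [Nat.sub_mul, one_mul, ← pow_succ', Nat.sub_add_cancel (by omega)]
  have hδ3 : δ3 = q ^ m - 1 - (q ^ (m - 1) + q ^ e + q ^ f) := by
    rcases hef with ⟨h, h1, h2⟩ | ⟨h, h1, h2⟩
    · rw [hδ3a h, hqY, ← h1, ← h2]; omega
    · rw [hδ3b h, hqY, ← h1, ← h2]; omega
  rw [hqY, ← he', ← hf'] at hδ2
  rw [hqY] at hδ1
  have hYm : 3 * q ^ (m - 1) ≤ q ^ m := three_mul_pow_le hq3 (by omega)
  have key : q ^ (m - 1) + q ^ e' + q ^ f' < q ^ (m - 1) + q ^ e + q ^ f ∧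
      q ^ (m - 1) + q ^ e + q ^ f < q ^ m - 1 ∧
      (∀ s, 0 < s → s < m → ∃ A B, B < q ^ s ∧ q ^ (m - 1) + q ^ e + q ^ f = A * q ^ s + B ∧
        B * q ^ (m - s) + A < q ^ (m - 1) + q ^ e + q ^ f) ∧
      ∀ b, 0 < b → Odd b → IsRotMax q m b → b ≠ q ^ (m - 1) →
        b ≠ q ^ (m - 1) + q ^ e' + q ^ f' → q ^ (m - 1) + q ^ e + q ^ f ≤ b := by
    rcases Nat.eq_or_lt_of_le hm with rfl | hm3
    · obtain rfl : e = 1 := by omega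
      obtain rfl : f = 1 := by omega
      obtain rfl : e' = 1 := by omega
      obtain rfl : f' = 0 := by omega
      have hq5 : 5 ≤ q := by nlinarith
      simp only [show 2 - 1 = 1 by omega, pow_one, pow_zero]
      refine ⟨by omega, ?_, ?_, ?_⟩
      · have : 5 * q ≤ q ^ 2 := by nlinarith
        omega
      · intro s hs0 hs2
        obtain rfl : s = 1 := by omega
        exact ⟨3, 0, by simp; omega, by ring, by omega⟩
      · intro b hb0 hbo hb h1 h2
        have := le_of_isRotMax_two hq3 hq hb hb0 hbo h1 (by omega)
        omega
    · have hfe : f < e := by omega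
      have hG : m < e + f + 2 ∧ (f + m < 2 * e + 1 ∨ f + m = 2 * e + 1 ∧ m - 2 - e < f) := by
        clear hδ1 hδ2 hδ3a hδ3b hδ3 hYm hqY hqm
        have hmod : m % 3 = 0 ∨ m % 3 = 1 ∨ m % 3 = 2 := by omega
        rcases hmod with hmod | hmod | hmod <;> rcases hef with hef | hef <;> omega
      have h3fe := three_mul_pow_le hq3 hfe
      have heY : q ^ e ≤ q ^ (m - 1) := Nat.pow_le_pow_right (by omega) (by omega)
      have hff : f' < e' := by omega
      have h3fe' := three_mul_pow_le hq3 hff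
      have hf0 := hp0 f
      have h9 : 3 * q ^ 1 ≤ q ^ (m - 1) := three_mul_pow_le hq3 (by omega)
      rw [pow_one] at h9
      refine ⟨?_, by omega, ?_, ?_⟩
      · rcases Nat.lt_or_ge e' e with h | h
        · have := three_mul_pow_le hq3 h
          omega
        · obtain rfl : e' = e := by omega
          have : 3 * q ^ f' ≤ q ^ f := three_mul_pow_le hq3 (by omega)
          have := hp0 f'
          omega
      · intro s hs0 hs
        exact exists_rotation_lt hq3 hfe (by omega) hG.1 hG.2 hs0 hs
      · intro b hb0 hbo hb h1 h2
        exact le_of_isRotMax_of_odd hq3 hq hm3 he' hf' hef hb hb0 hbo h1 h2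
  obtain ⟨hlt, hb3, hrot, hmax⟩ := key
  have hL := isCosetLeader_and_ncard_cycCoset (by have := hp0 e; omega) hb3 hrot
  rw [← hδ3] at hL
  have o1 := hpo m
  have o2 := hpo (m - 1)
  have o3 := hpo e
  have o4 := hpo f
  refine ⟨Nat.odd_iff.2 (by omega), hL.1, by omega, by omega, ?_, hL.2⟩
  intro i hio hi h1 h2
  have hio' := Nat.odd_iff.1 hio
  have hiN := hi.1
  have := hmax (q ^ m - 1 - i) (by omega) (Nat.odd_iff.2 (by omega))
    (hi.isRotMax (by omega)) (by omega) (by omega)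
  omega
end

section
/- Let q be an odd prime power, m ≥ 2, and n = (q^m+1)/2. Define δ1 = (q^m+1)/2 if q^m ≡ 1 (mod 4), and δ1 = (q−1)(q^m+1)/(2(q+1)) if q^m ≡ 3 (mod 4). Then δ1 is the largest odd coset leader modulo q^m + 1: δ1 is odd, δ1 is a coset leader modulo q^m + 1, and every odd coset leader modulo q^m + 1 is at most δ1. Moreover, |C_{δ1}^{(q, q^m+1)}| = 1 if q^m ≡ 1 (mod 4) and |C_{δ1}^{(q, q^m+1)}| = 2 if q^m ≡ 3 (mod 4). -/
lemma IsCosetLeader.le_of_modEq {q N i j r : ℕ} (h : IsCosetLeader q N i)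
    (hr : i * q ^ j ≡ r [MOD N]) : i ≤ r := by
  have := h.2 j
  rw [hr] at this
  exact this.trans (Nat.mod_le _ _)

lemma IsCosetLeader.two_mul_le {q m i : ℕ} (h : IsCosetLeader q (q ^ m + 1) i) :
    2 * i ≤ q ^ m + 1 := by
  have hi := h.1
  have : i ≤ q ^ m + 1 - i := by
    refine h.le_of_modEq (j := m) ?_
    rw [Nat.modEq_iff_dvd]
    refine ⟨1 - i, ?_⟩
    push_cast [hi.le]
    ring
  omega

lemma mul_pow_mod_eq_self {q N i : ℕ} (hi : i < N) (h : i * q ≡ i [MOD N]) (j : ℕ) :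
    (i * q ^ j) % N = i := by
  induction j with
  | zero => simpa using Nat.mod_eq_of_lt hi
  | succ j ih =>
    have h1 : i * q ^ j ≡ i [MOD N] := by rw [Nat.ModEq, ih, Nat.mod_eq_of_lt hi]
    have h2 : i * q ^ (j + 1) ≡ i [MOD N] := by
      rw [pow_succ, ← mul_assoc]
      exact (h1.mul_right q).trans h
    rw [h2, Nat.mod_eq_of_lt hi]

lemma mul_pow_mod_eq_or {q N i : ℕ} (hi0 : 0 < i) (hi : i < N) (h : N ∣ i * (q + 1)) (j : ℕ) :
    (i * q ^ j) % N = i ∨ (i * q ^ j) % N = N - i := by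
  have h' : (N : ℤ) ∣ i * (q + 1) := by exact_mod_cast h
  induction j with
  | zero => left; simpa using Nat.mod_eq_of_lt hi
  | succ j ih =>
    rcases ih with ih | ih
    · right
      have h1 : i * q ^ j ≡ i [MOD N] := by rw [Nat.ModEq, ih, Nat.mod_eq_of_lt hi]
      have h2 : i * q ≡ N - i [MOD N] := by
        rw [Nat.modEq_iff_dvd]
        obtain ⟨c, hc⟩ := h'
        refine ⟨1 - c, ?_⟩
        rw [Nat.cast_sub hi.le]
        push_cast
        linear_combination -hc
      have h3 := (h1.mul_right q).trans h2
      rw [pow_succ, ← mul_assoc, h3, Nat.mod_eq_of_lt (by omega)]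
    · left
      have h1 : i * q ^ j ≡ N - i [MOD N] := by
        rw [Nat.ModEq, ih, Nat.mod_eq_of_lt (by omega)]
      have h2 : (N - i) * q ≡ i [MOD N] := by
        rw [Nat.modEq_iff_dvd]
        obtain ⟨c, hc⟩ := h'
        refine ⟨c - q, ?_⟩
        push_cast [Nat.cast_sub hi.le]
        linear_combination hc
      have h3 := (h1.mul_right q).trans h2
      rw [pow_succ, ← mul_assoc, h3, Nat.mod_eq_of_lt hi]

lemma exists_odd_pow_add_one_eq_mul {q : ℤ} (hq : Odd q) (k : ℕ) :
    ∃ a, Odd a ∧ q ^ (2 * k + 1) + 1 = a * (q + 1) := by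
  induction k with
  | zero => exact ⟨1, odd_one, by ring⟩
  | succ k ih =>
    obtain ⟨a, ha, h⟩ := ih
    refine ⟨q ^ 2 * a - (q - 1), (hq.pow.mul ha).sub_even (hq.sub_odd odd_one), ?_⟩
    linear_combination q ^ 2 * h

/-- With `q ^ m + 1 = 2 * H = A * (q + 1)`, a coset leader other than `H` is at most `H - A`. -/
lemma IsCosetLeader.add_le_of_ne {q m i H A : ℕ} (hq : Odd q) (hq1 : 1 < q)
    (hH : q ^ m + 1 = 2 * H) (hA : q ^ m + 1 = A * (q + 1)) (hne : i ≠ H)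
    (h : IsCosetLeader q (q ^ m + 1) i) : i + A ≤ H := by
  have hle := h.two_mul_le
  by_contra! hlt
  obtain ⟨t, rfl⟩ : ∃ t, H = i + t := ⟨H - i, by omega⟩
  have ht : 0 < t := by omega
  have htA : t < A := by omega
  have hex : ∃ j, A ≤ t * q ^ j :=
    ⟨A, (Nat.lt_pow_self hq1).le.trans (Nat.le_mul_of_pos_left _ ht)⟩
  obtain ⟨j, hj, hjmin⟩ : ∃ j, A ≤ t * q ^ (j + 1) ∧ t * q ^ j < A := by
    classical
    have hs := Nat.find_spec hex
    have hm := fun k => Nat.find_min hex (m := k)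
    cases hf : Nat.find hex with
    | zero => rw [hf] at hs; simp at hs; omega
    | succ k => exact ⟨k, hf ▸ hs, by have := hm k (by omega); omega⟩
  have hsA : t * q ^ (j + 1) + A ≤ 2 * (i + t) := by
    rw [← hH, hA, pow_succ]
    nlinarith
  obtain ⟨k, hk⟩ := hq.pow (n := j + 1)
  have hN : ((q ^ m + 1 : ℕ) : ℤ) = 2 * (i + t) := by exact_mod_cast hH
  have hNq : (q : ℤ) ^ m = 2 * (i + t) - 1 := by push_cast at hN; linarith
  have hk' : (q : ℤ) ^ (j + 1) = 2 * k + 1 := by exact_mod_cast hk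
  rcases le_total (t * q ^ (j + 1)) (i + t) with hc | hc
  · have : i ≤ i + t - t * q ^ (j + 1) := by
      refine h.le_of_modEq (j := j + 1) ?_
      rw [Nat.modEq_iff_dvd, hN]
      refine ⟨-k, ?_⟩
      push_cast [hc]
      rw [hk']
      ring
    omega
  · have : i ≤ t * q ^ (j + 1) - (i + t) := by
      refine h.le_of_modEq (j := j + 1 + m) ?_
      rw [Nat.modEq_iff_dvd, hN]
      refine ⟨k - i * (2 * k + 1), ?_⟩
      push_cast [hc]
      rw [pow_add _ (j + 1) m, hk', hNq]
      ring
    omega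

theorem stmt11 (q m : ℕ) (hq : Odd q) (hpp : IsPrimePow q) (hm : 2 ≤ m)
    (δ1 : ℕ)
    (hδ1a : q ^ m % 4 = 1 → δ1 = (q ^ m + 1) / 2)
    (hδ1b : q ^ m % 4 = 3 → δ1 = (q - 1) * (q ^ m + 1) / (2 * (q + 1))) :
    Odd δ1 ∧
    IsCosetLeader q (q ^ m + 1) δ1 ∧
    (∀ i : ℕ, Odd i → IsCosetLeader q (q ^ m + 1) i → i ≤ δ1) ∧
    (q ^ m % 4 = 1 → (cycCoset q (q ^ m + 1) δ1).ncard = 1) ∧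
    (q ^ m % 4 = 3 → (cycCoset q (q ^ m + 1) δ1).ncard = 2) := by
  have hodd : Odd (q ^ m) := hq.pow
  have hcase : q ^ m % 4 = 1 ∨ q ^ m % 4 = 3 := by
    rw [Nat.odd_iff] at hodd; omega
  rcases hcase with h1 | h3
  · have hδ := hδ1a h1
    have h2δ : q ^ m + 1 = 2 * δ1 := by omega
    have hlt : δ1 < q ^ m + 1 := by omega
    have hmod : δ1 * q ≡ δ1 [MOD q ^ m + 1] := by
      obtain ⟨k, hk⟩ := hq
      rw [Nat.modEq_iff_dvd, h2δ, hk]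
      exact ⟨-k, by push_cast; ring⟩
    have hall := mul_pow_mod_eq_self hlt hmod
    refine ⟨by rw [Nat.odd_iff]; omega, ⟨hlt, fun j => (hall j).ge⟩, ?_, ?_, by omega⟩
    · intro i _ hi
      have := hi.two_mul_le
      omega
    · intro _
      have : cycCoset q (q ^ m + 1) δ1 = {δ1} := by
        ext a
        simp [cycCoset, hall]
      rw [this, Set.ncard_singleton]
  · have hqm : Odd m := by
      by_contra hm'
      obtain ⟨k, rfl⟩ := Nat.not_odd_iff_even.mp hm'
      rw [← two_mul, pow_mul, Nat.pow_mod] at h3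
      have : q ^ 2 % 4 = 1 := by
        rw [Nat.odd_iff] at hq
        have : q % 4 = 1 ∨ q % 4 = 3 := by omega
        rcases this with h | h <;> simp [Nat.pow_mod, h]
      simp [this] at h3
    have hq3 : q % 4 = 3 := by
      rw [Nat.odd_iff] at hq
      have : q % 4 = 1 ∨ q % 4 = 3 := by omega
      rcases this with h | h
      · simp [Nat.pow_mod, h] at h3
      · exact h
    obtain ⟨A, hA⟩ : q + 1 ∣ q ^ m + 1 := by
      simpa using hqm.nat_add_dvd_pow_add_pow q 1
    rw [mul_comm] at hA
    obtain ⟨p, rfl⟩ : ∃ p, q = 4 * p + 3 := ⟨q / 4, by omega⟩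
    set Q := (4 * p + 3) ^ m with hQ
    have hδ : δ1 = (2 * p + 1) * A := by
      rw [hδ1b h3, hA]
      refine Nat.div_eq_of_eq_mul_left (by omega) ?_
      rw [show 4 * p + 3 - 1 = 2 * (2 * p + 1) by omega]
      ring
    have hAodd : Odd A := by
      obtain ⟨k, rfl⟩ := hqm
      obtain ⟨a, ha, hAa⟩ := exists_odd_pow_add_one_eq_mul (q := ((4 * p + 3 : ℕ) : ℤ))
        (by exact_mod_cast hq) k
      have hA' : ((4 * p + 3 : ℕ) : ℤ) ^ (2 * k + 1) + 1 = A * (((4 * p + 3 : ℕ) : ℤ) + 1) := by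
        exact_mod_cast hA
      have hAeq : (A : ℤ) = a :=
        mul_right_cancel₀ (by positivity) (hA'.symm.trans hAa)
      exact_mod_cast hAeq ▸ ha
    have hApos : 0 < A := hAodd.pos
    have hH : Q + 1 = 2 * (δ1 + A) := by rw [hA, hδ]; ring
    have hδpos : 0 < δ1 := by rw [hδ]; positivity
    have hδodd : Odd δ1 := by rw [hδ]; exact (odd_two_mul_add_one p).mul hAodd
    have hlt : δ1 < Q + 1 := by omega
    have hdvd : Q + 1 ∣ δ1 * (4 * p + 3 + 1) := ⟨2 * p + 1, by rw [hA, hδ]; ring⟩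
    have hall := mul_pow_mod_eq_or hδpos hlt hdvd
    refine ⟨hδodd, ⟨hlt, fun j => ?_⟩, ?_, by omega, ?_⟩
    · rcases hall j with h | h <;> omega
    · intro i hio hi
      have hne : i ≠ δ1 + A := by
        rintro rfl
        exact (Nat.not_even_iff_odd.mpr hio) (hδodd.add_odd hAodd)
      have := hi.add_le_of_ne hq (by omega) hH hA hne
      omega
    · intro _
      have : cycCoset (4 * p + 3) (Q + 1) δ1 = {δ1, Q + 1 - δ1} := by
        ext a
        simp only [cycCoset, Set.mem_ofPred_eq, Set.mem_insert_iff, Set.mem_singleton_iff]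
        constructor
        · rintro ⟨j, rfl⟩
          exact hall j
        · rintro (rfl | rfl)
          · exact ⟨0, by simpa using (Nat.mod_eq_of_lt hlt).symm⟩
          · refine ⟨1, ?_⟩
            have h2 : δ1 * (4 * p + 3) ≡ Q + 1 - δ1 [MOD Q + 1] := by
              have h' : ((Q + 1 : ℕ) : ℤ) ∣ δ1 * (4 * p + 3 + 1) := by exact_mod_cast hdvd
              rw [Nat.modEq_iff_dvd, Nat.cast_sub hlt.le]
              obtain ⟨c, hc⟩ := h'
              refine ⟨1 - c, ?_⟩
              push_cast at hc ⊢
              linear_combination -hc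
            rw [pow_one, h2, Nat.mod_eq_of_lt (by omega)]
      rw [this, Set.ncard_pair (by omega)]
end

section
/- Let q be an odd prime power with q^m ≡ 1 (mod 4) and m ≥ 2. Let i be an odd integer with (q^m−1)/2 − q^{m−1} < i < (q^m+1)/2 whose base-q expansion is i = ((q−3)/2)·q^{m−1} + i_{m−2}q^{m−2} + ... + i_1 q + i_0, where every digit i_0, i_1, ..., i_{m−2} belongs to {(q−3)/2, (q−1)/2, (q+1)/2}. Then i is not a coset leader modulo q^m + 1. -/
/-- If all balanced residues `D k` of `D 0 * q ^ k` modulo `q * M + 1` are smaller than `M` in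
absolute value, then the parity of the quotient is governed by the sign of the residue. -/
theorem exists_quotient_parity_of_abs_lt {q M : ℤ} (hq : Odd q) (hq0 : 0 < q) (D : ℕ → ℤ)
    (hD : ∀ k, q * M + 1 ∣ q * D k - D (k + 1)) (hlt : ∀ k, |D k| < M) (h0 : 0 < D 0) (k : ℕ) :
    ∃ Q : ℤ, D 0 * q ^ k = D k + (q * M + 1) * Q ∧
      (Even Q ∧ 0 < D k ∨ Odd Q ∧ D k < 0) := by
  induction k with
  | zero => exact ⟨0, by simp, Or.inl ⟨by simp, h0⟩⟩
  | succ k ih =>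
    obtain ⟨Q, hQ, hsign⟩ := ih
    obtain ⟨t, ht⟩ := hD k
    obtain ⟨h1, h2⟩ := abs_lt.mp (hlt k)
    obtain ⟨h3, h4⟩ := abs_lt.mp (hlt (k + 1))
    have hM : 0 < M := by linarith
    have h5 : q * D k < q * M := mul_lt_mul_of_pos_left h2 hq0
    have h6 : q * (-M) < q * D k := mul_lt_mul_of_pos_left h1 hq0
    have h7 : M ≤ q * M := by nlinarith
    have ht1 : t < 2 := by
      by_contra! h
      nlinarith
    have ht2 : -2 < t := by
      by_contra! h
      nlinarith
    refine ⟨t + q * Q, by rw [pow_succ]; linear_combination q * hQ + ht, ?_⟩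
    have hcases : t = -1 ∨ t = 0 ∨ t = 1 := by omega
    rcases hcases with rfl | rfl | rfl
    · have hneg : D k < 0 := by
        by_contra! h
        nlinarith
      rcases hsign with ⟨_, hpos⟩ | ⟨hodd, _⟩
      · linarith
      · exact Or.inl ⟨(by decide : Odd (-1 : ℤ)).add_odd (hq.mul hodd), by linarith⟩
    · rw [zero_add]
      rcases hsign with ⟨heven, hpos⟩ | ⟨hodd, hneg⟩
      · exact Or.inl ⟨heven.mul_left q, by nlinarith⟩
      · exact Or.inr ⟨hq.mul hodd, by nlinarith⟩
    · have hpos : 0 < D k := by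
        by_contra! h
        nlinarith
      rcases hsign with ⟨heven, _⟩ | ⟨_, hneg⟩
      · exact Or.inr ⟨odd_one.add_even (heven.mul_left q), by linarith⟩
      · linarith

/-- The residues modulo `q ^ m + 1` along the coset of a coset leader `i` are at most
`q ^ m + 1 - i`. -/
theorem IsCosetLeader.mod_add_le {q m i : ℕ} (h : IsCosetLeader q (q ^ m + 1) i)
    (k : ℕ) : (i * q ^ k) % (q ^ m + 1) + i ≤ q ^ m + 1 := by
  have h1 := h.2 k
  have h2 := h.2 (k + m)
  have hN : 0 < q ^ m + 1 := by positivity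
  have h3 := Nat.mod_lt (i * q ^ k) hN
  have h4 := Nat.mod_lt (i * q ^ (k + m)) hN
  have hdvd : q ^ m + 1 ∣ (i * q ^ k) % (q ^ m + 1) + (i * q ^ (k + m)) % (q ^ m + 1) := by
    rw [Nat.dvd_iff_mod_eq_zero, ← Nat.add_mod, ← Nat.dvd_iff_mod_eq_zero]
    exact ⟨i * q ^ k, by ring⟩
  obtain ⟨t, ht⟩ := hdvd
  have ht2 : t < 2 := by
    by_contra! h
    nlinarith
  interval_cases t <;> omega

/-- An odd `i` just below the odd number `(q ^ m + 1) / 2` is not a coset leader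
modulo `q ^ m + 1`. -/
theorem not_isCosetLeader_of_odd {q n i h : ℕ} (hq : Odd q) (hh : q ^ (n + 1) + 1 = 2 * h)
    (hhodd : Odd h) (hi : Odd i) (hih : i < h) (hle : h ≤ i + q ^ n) :
    ¬ IsCosetLeader q (q ^ (n + 1) + 1) i := by
  intro hlead
  have hq0 : 0 < q := hq.pos
  set r : ℕ → ℕ := fun k => (i * q ^ k) % (q ^ (n + 1) + 1) with hr
  have hlow (k : ℕ) : i ≤ r k := hlead.2 k
  have hupp (k : ℕ) : r k + i ≤ 2 * h := hh ▸ hlead.mod_add_le k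
  have hrdiv (k : ℕ) : (r k : ℤ) + 2 * h * ((i * q ^ k / (2 * h) : ℕ) : ℤ) = i * q ^ k := by
    have := Nat.mod_add_div (i * q ^ k) (2 * h)
    simp only [hr, hh]
    exact_mod_cast this
  have hrodd (k : ℕ) : Odd (r k) := by
    have h1 : Odd (i * q ^ k) := hi.mul hq.pow
    have h2 := Nat.mod_add_div (i * q ^ k) (2 * h)
    rw [← h2, mul_assoc] at h1
    simp only [hr, hh]
    exact (Nat.odd_add.mp h1).mpr (even_two_mul _)
  have hpowodd : Odd (q ^ n) := hq.pow
  have hr0 : r 0 = i := by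
    simp only [hr, pow_zero, mul_one]
    exact Nat.mod_eq_of_lt hlead.1
  have hN : (q : ℤ) * (q : ℤ) ^ n + 1 = 2 * h := by
    rw [← pow_succ']
    exact_mod_cast hh
  have hdvd (k : ℕ) :
      (q : ℤ) * (q : ℤ) ^ n + 1 ∣ q * ((h : ℤ) - r k) - ((h : ℤ) - r (k + 1)) := by
    obtain ⟨s, hs⟩ := hq
    have hs' : (q : ℤ) = 2 * s + 1 := by exact_mod_cast hs
    rw [hN]
    refine ⟨s + q * ((i * q ^ k / (2 * h) : ℕ) : ℤ)
      - ((i * q ^ (k + 1) / (2 * h) : ℕ) : ℤ), ?_⟩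
    linear_combination (-(q : ℤ)) * hrdiv k + hrdiv (k + 1) + (h : ℤ) * hs'
  have hlt (k : ℕ) : |(h : ℤ) - r k| < (q : ℤ) ^ n := by
    have h1 := hlow k
    have h2 := hupp k
    obtain ⟨a, ha⟩ := hrodd k
    obtain ⟨b, hb⟩ := hhodd
    obtain ⟨c, hc⟩ := hpowodd
    have hc' : (q : ℤ) ^ n = 2 * c + 1 := by exact_mod_cast hc
    rw [hc', abs_lt]
    omega
  obtain ⟨Q, hQ, hsign⟩ := exists_quotient_parity_of_abs_lt (q := q) (M := (q : ℤ) ^ n)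
    (by exact_mod_cast hq) (by exact_mod_cast hq0) (fun k => (h : ℤ) - r k) hdvd hlt
    (by simp only [hr0]; omega) (n + 1)
  simp only [hr0, hN] at hQ hsign
  have hsum : ((h : ℤ) - i) + (h - r (n + 1)) = 2 * h * ((h - i) - Q) := by
    rw [pow_succ'] at hQ
    linear_combination ((h : ℤ) - i) * hN - hQ
  have h1 := hlow (n + 1)
  have h2 := hupp (n + 1)
  have hi0 := hi.pos
  have hQlt : (h : ℤ) - i - Q < 1 := by
    by_contra! hc
    nlinarith
  have hQgt : -1 < (h : ℤ) - i - Q := by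
    by_contra! hc
    nlinarith
  have hQeq : Q = (h : ℤ) - i := by omega
  have hQeven : Even Q := by
    rw [hQeq]
    exact Odd.sub_odd (by exact_mod_cast hhodd) (by exact_mod_cast hi)
  rcases hsign with ⟨_, hpos⟩ | ⟨hodd, _⟩
  · rw [hQeq, sub_self, mul_zero] at hsum
    omega
  · exact (Int.not_odd_iff_even.mpr hQeven) hodd

theorem stmt13 (q m : ℕ) (hq : Odd q) (hpp : IsPrimePow q) (hm : 2 ≤ m)
    (hqm4 : q ^ m % 4 = 1)
    (i : ℕ) (hiodd : Odd i)
    (hilb : (q ^ m - 1) / 2 - q ^ (m - 1) < i) (hiub : i < (q ^ m + 1) / 2)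
    (c : ℕ → ℕ)
    (hexp : i = ∑ j ∈ Finset.range m, c j * q ^ j)
    (htop : c (m - 1) = (q - 3) / 2)
    (hdig : ∀ j : ℕ, j < m - 1 →
      c j = (q - 3) / 2 ∨ c j = (q - 1) / 2 ∨ c j = (q + 1) / 2) :
    ¬ IsCosetLeader q (q ^ m + 1) i := by
  obtain ⟨n, rfl⟩ : ∃ n, m = n + 1 := ⟨m - 1, by omega⟩
  rw [Nat.add_sub_cancel] at hilb
  have hq3 : 3 ≤ q := by
    have := hpp.one_lt
    obtain ⟨a, ha⟩ := hq
    omega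
  have hpow : q ^ n * 3 ≤ q ^ (n + 1) := Nat.mul_le_mul_left _ hq3
  have hpos : 0 < q ^ n := by positivity
  have hh : q ^ (n + 1) + 1 = 2 * ((q ^ (n + 1) + 1) / 2) := by omega
  refine not_isCosetLeader_of_odd hq hh ?_ hiodd hiub ?_
  · rw [Nat.odd_iff]
    omega
  · omega
end

section
/- Let q be an odd prime power and m ≥ 2. Define δ2 = (q^m−1)/2 − q^{m−1} if q^m ≡ 1 (mod 4), and δ2 = (q−1)(q^m − 2q^{m−2} − 1)/(2(q+1)) if q^m ≡ 3 (mod 4), and let δ1 be the largest odd coset leader modulo q^m + 1 (δ1 = (q^m+1)/2 if q^m ≡ 1 (mod 4) and δ1 = (q−1)(q^m+1)/(2(q+1)) if q^m ≡ 3 (mod 4)). Then δ2 is the second largest odd coset leader modulo q^m + 1: δ2 is odd, δ2 is a coset leader modulo q^m + 1, δ2 < δ1, and every odd coset leader modulo q^m + 1 other than δ1 is at most δ2. Moreover |C_{δ2}^{(q, q^m+1)}| = 2m. -/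
/-- Multiplication by `q ^ m` negates residues modulo `q ^ m + 1`. -/
theorem dvd_mul_pow_add_add (q x : ℤ) (m j : ℕ) :
    q ^ m + 1 ∣ x * q ^ (j + m) + x * q ^ j :=
  ⟨x * q ^ j, by ring⟩

/-- If `i = c - u` with `2 c = q ^ m + 1`, then `r ≡ u q ^ j` controls the residue of `i q ^ j`. -/
theorem lt_mul_pow_emod {q c i u : ℕ} (hq : Odd q) (hc : c = i + u) (hi : 0 < i) (j : ℕ) (r : ℤ)
    (hr : (2 * c : ℤ) ∣ r - u * q ^ j) (h1 : -(u : ℤ) ≤ r) (h2 : r < u) :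
    i < (i * q ^ j) % (2 * c) := by
  obtain ⟨k, hk⟩ := hr
  obtain ⟨l, hl⟩ : Odd ((q : ℤ) ^ j) := by exact_mod_cast hq.pow
  have hcz : (c : ℤ) = i + u := by exact_mod_cast hc
  have key : (i * q ^ j : ℤ) % (2 * c) = c - r := by
    have e : (i * q ^ j : ℤ) = (c - r) + (2 * c) * (l + k) := by
      have : (i : ℤ) = c - u := by linarith
      rw [this]
      linear_combination hk + (c : ℤ) * hl
    rw [e, Int.add_mul_emod_self_left]
    apply Int.emod_eq_of_lt <;> omega
  zify
  rw [key]
  omega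

theorem isCosetLeader_and_ncard {q m c i u : ℕ} (hq : Odd q) (hm : 0 < m)
    (hN : q ^ m + 1 = 2 * c) (hc : c = i + u) (hi : 0 < i) (hu : 0 < u)
    (H : ∀ j, 0 < j → j < m → ∃ r : ℤ, (2 * c : ℤ) ∣ r - u * q ^ j ∧ |r| < u) :
    IsCosetLeader q (q ^ m + 1) i ∧ (cycCoset q (q ^ m + 1) i).ncard = 2 * m := by
  have hNz : (q : ℤ) ^ m + 1 = 2 * c := by exact_mod_cast hN
  have key : ∀ j, 0 < j → j < 2 * m → i < (i * q ^ j) % (q ^ m + 1) := by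
    intro j h0 hj
    rw [hN]
    rcases lt_trichotomy j m with h | h | h
    · obtain ⟨r, hr, hlt⟩ := H j h0 h
      rw [abs_lt] at hlt
      exact lt_mul_pow_emod hq hc hi j r hr hlt.1.le hlt.2
    · subst h
      refine lt_mul_pow_emod hq hc hi j (-u) ⟨-u, ?_⟩ le_rfl (by omega)
      linear_combination (-(u : ℤ)) * hNz
    · obtain ⟨r, hr, hlt⟩ := H (j - m) (by omega) (by omega)
      rw [abs_lt] at hlt
      refine lt_mul_pow_emod hq hc hi j (-r) ?_ (by omega) (by omega)
      obtain ⟨k, hk⟩ := hr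
      obtain ⟨l, hl⟩ := dvd_mul_pow_add_add (q : ℤ) u m (j - m)
      rw [hNz, Nat.sub_add_cancel h.le] at hl
      exact ⟨-k - l, by linear_combination -hk - hl⟩
  have hiN : i < q ^ m + 1 := by omega
  have hper : ∀ j, (i * q ^ j) % (q ^ m + 1) = (i * q ^ (j % (2 * m))) % (q ^ m + 1) := by
    intro j
    have h1 : q ^ (2 * m) ≡ 1 [MOD q ^ m + 1] := by
      refine (Nat.modEq_iff_dvd.2 ⟨1 - (q : ℤ) ^ m, ?_⟩)
      push_cast
      ring
    have h2 : i * q ^ j ≡ i * q ^ (j % (2 * m)) [MOD q ^ m + 1] := by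
      conv_lhs => rw [← Nat.mod_add_div j (2 * m), pow_add, pow_mul]
      simpa using ((h1.pow (j / (2 * m))).mul_left (q ^ (j % (2 * m)))).mul_left i
    exact h2
  have hlt : ∀ j, j % (2 * m) < 2 * m := fun j => Nat.mod_lt _ (by omega)
  refine ⟨⟨hiN, fun j => ?_⟩, ?_⟩
  · rw [hper]
    rcases Nat.eq_zero_or_pos (j % (2 * m)) with h | h
    · rw [h, pow_zero, mul_one, Nat.mod_eq_of_lt hiN]
    · exact (key _ h (hlt j)).le
  · have hset : cycCoset q (q ^ m + 1) i
        = ((Finset.range (2 * m)).image fun j => (i * q ^ j) % (q ^ m + 1) : Finset ℕ) := by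
      ext a
      simp only [cycCoset, Set.mem_ofPred_eq, Finset.coe_image, Finset.coe_range, Set.mem_image,
        Set.mem_Iio]
      constructor
      · rintro ⟨j, rfl⟩
        exact ⟨j % (2 * m), hlt j, (hper j).symm⟩
      · rintro ⟨j, -, rfl⟩
        exact ⟨j, rfl⟩
    have hcop : Nat.Coprime (q ^ m + 1) q := by
      have : Nat.Coprime (q ^ m + 1) (q ^ m) := by simp
      exact Nat.Coprime.coprime_dvd_right (dvd_pow_self q hm.ne') this
    have hne : ∀ a b, a < b → b < 2 * m →
        (i * q ^ a) % (q ^ m + 1) ≠ (i * q ^ b) % (q ^ m + 1) := by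
      intro a b hab hb h
      have h1 : i * q ^ a ≡ (i * q ^ (b - a)) * q ^ a [MOD q ^ m + 1] := by
        rw [mul_assoc, ← pow_add, Nat.sub_add_cancel hab.le]
        exact h
      have h2 := Nat.ModEq.cancel_right_of_coprime (hcop.pow_right a) h1
      have h3 := key (b - a) (by omega) (by omega)
      have h4 : i % (q ^ m + 1) = (i * q ^ (b - a)) % (q ^ m + 1) := h2
      rw [Nat.mod_eq_of_lt hiN] at h4
      omega
    rw [hset, Set.ncard_coe_finset, Finset.card_image_of_injOn, Finset.card_range]
    intro a ha b hb hab
    simp only [Finset.coe_range, Set.mem_Iio] at ha hb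
    rcases lt_trichotomy a b with h | h | h
    · exact (hne a b h hb hab).elim
    · exact h
    · exact (hne b a h ha hab.symm).elim

/-- The orbit of a coset leader, measured by the signed distance to half the modulus. -/
theorem IsCosetLeader.exists_orbit {q m c i : ℕ} (hq : Odd q) (hN : q ^ m + 1 = 2 * c)
    (hi : 0 < i) (h : IsCosetLeader q (q ^ m + 1) i) :
    i ≤ c ∧ ∃ r : ℕ → ℤ, r 0 = c - i ∧ r m = -r 0 ∧ (∀ j, |r j| ≤ c - i) ∧
      ∀ j, ∃ k : ℤ, r (j + 1) = q * r j + k * (2 * c) := by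
  have hNz : (q : ℤ) ^ m + 1 = 2 * c := by exact_mod_cast hN
  obtain ⟨hiN, hle⟩ := h
  rw [hN] at hiN hle
  have hneg : ∀ j, (i * q ^ (j + m)) % (2 * c) = 2 * c - (i * q ^ j) % (2 * c) := by
    intro j
    have h1 := hle j
    have h2 : (i * q ^ j) % (2 * c) < 2 * c := Nat.mod_lt _ (by omega)
    obtain ⟨k, hk⟩ := dvd_mul_pow_add_add (q : ℤ) i m j
    rw [hNz] at hk
    have h3 := Int.emod_add_mul_ediv (i * q ^ j : ℤ) (2 * c)
    have h4 : (i * q ^ (j + m) : ℤ) % (2 * c) = 2 * c - (i * q ^ j : ℤ) % (2 * c) := by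
      have e : (i * q ^ (j + m) : ℤ) = (2 * c - (i * q ^ j : ℤ) % (2 * c))
          + (2 * c) * (k - 1 - (i * q ^ j : ℤ) / (2 * c)) := by
        linear_combination hk + h3
      conv_lhs => rw [e]
      rw [Int.add_mul_emod_self_left]
      have h5 : ((i * q ^ j : ℤ) % (2 * c)) = ((i * q ^ j % (2 * c) : ℕ) : ℤ) := by push_cast; rfl
      apply Int.emod_eq_of_lt <;> rw [h5] <;> omega
    zify [h2.le]
    exact h4
  have h0 : (i * q ^ 0) % (2 * c) = i := by rw [pow_zero, mul_one, Nat.mod_eq_of_lt hiN]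
  have hm0 := hneg 0
  have hm1 := hle (0 + m)
  rw [h0, zero_add] at hm0
  rw [zero_add] at hm1
  refine ⟨by omega, fun j => c - ((i * q ^ j % (2 * c) : ℕ) : ℤ), ?_, ?_, ?_, ?_⟩
  · simp only [h0]
  · simp only [h0, hm0]
    omega
  · intro j
    have h1 := hle j
    have h2 := hle (j + m)
    rw [hneg] at h2
    rw [abs_le]
    constructor <;> dsimp only <;> omega
  · intro j
    obtain ⟨l, hl⟩ : Odd (q : ℤ) := by exact_mod_cast hq
    have h1 := Int.emod_add_mul_ediv (i * q ^ j : ℤ) (2 * c)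
    have h2 := Int.emod_add_mul_ediv (i * q ^ (j + 1) : ℤ) (2 * c)
    refine ⟨(i * q ^ (j + 1) : ℤ) / (2 * c) - q * ((i * q ^ j : ℤ) / (2 * c)) - l, ?_⟩
    push_cast
    linear_combination (q : ℤ) * h1 - h2 - (c : ℤ) * hl

/-- One step of an orbit staying within `u`, where `q * u` is smaller than the modulus. -/
theorem orbit_step {q N u r s k : ℤ} (hq : 1 ≤ q) (hu : q * u < N) (hr : |r| ≤ u) (hs : |s| ≤ u)
    (h : s = q * r + k * N) :
    s = q * r ∨ (0 < r ∧ s < 0 ∧ s = q * r - N) ∨ (r < 0 ∧ 0 < s ∧ s = q * r + N) := by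
  rw [abs_le] at hr hs
  have hu0 : 0 ≤ u := by linarith
  have h1 : q * r ≤ q * u := by nlinarith
  have h2 : -(q * u) ≤ q * r := by nlinarith
  have h3 : u ≤ q * u := by nlinarith
  have hN : 0 < N := by linarith
  have hk1 : k < 2 := by
    by_contra! hk
    nlinarith
  have hk2 : -2 < k := by
    by_contra! hk
    nlinarith
  have hk : k = -1 ∨ k = 0 ∨ k = 1 := by omega
  rcases hk with rfl | rfl | rfl
  · refine Or.inr (Or.inl ⟨?_, by linarith, by linarith⟩)
    by_contra! hc
    have : q * r ≤ 0 := by nlinarith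
    linarith
  · exact Or.inl (by linarith)
  · refine Or.inr (Or.inr ⟨?_, by linarith, by linarith⟩)
    by_contra! hc
    have : 0 ≤ q * r := by nlinarith
    linarith

theorem no_small_even_orbit {q c u : ℤ} {m : ℕ} (hq : 1 ≤ q) (hqo : Odd q) (hc : Odd c)
    (hu0 : 0 < u) (hue : Even u) (hu : q * u < 2 * c) (r : ℕ → ℤ) (h0 : r 0 = u)
    (hm : r m = -r 0) (hb : ∀ j, |r j| ≤ u) (hs : ∀ j, ∃ k : ℤ, r (j + 1) = q * r j + k * (2 * c)) :
    False := by
  have inv : ∀ j, (0 < r j ∧ r j % 4 = u % 4) ∨ (r j < 0 ∧ r j % 4 = (u + 2) % 4) := by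
    intro j
    induction j with
    | zero => rw [h0]; omega
    | succ j ih =>
      obtain ⟨k, hk⟩ := hs j
      have hst := orbit_step hq hu (hb j) (hb (j + 1)) hk
      obtain ⟨a, ha⟩ := hqo
      obtain ⟨b, hb'⟩ := hc
      obtain ⟨d, hd⟩ := hue
      obtain ⟨e, he⟩ : ∃ e, r j = 2 * e := ⟨r j / 2, by omega⟩
      have hqr : q * r j = r j + 4 * (a * e) := by rw [ha, he]; ring
      rcases hst with h | ⟨h1, h2, h⟩ | ⟨h1, h2, h⟩
      · rcases ih with ih | ih
        · left; exact ⟨by rw [h]; nlinarith, by omega⟩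
        · right; exact ⟨by rw [h]; nlinarith, by omega⟩
      · right; exact ⟨h2, by omega⟩
      · left; exact ⟨h2, by omega⟩
  have := inv m
  obtain ⟨d, hd⟩ := hue
  omega

theorem abs_orbit_step {q N u r s k : ℤ} (hq : 1 ≤ q) (hu : q * u < N) (hr : |r| ≤ u)
    (hs : |s| ≤ u) (h : s = q * r + k * N) : |s| = q * |r| ∨ |s| = N - q * |r| := by
  rcases orbit_step hq hu hr hs h with h | ⟨h1, h2, h⟩ | ⟨h1, h2, h⟩
  · left; rw [h, abs_mul, abs_of_nonneg (by linarith : (0 : ℤ) ≤ q)]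
  · right; rw [abs_of_pos h1, abs_of_neg h2]; linarith
  · right; rw [abs_of_neg h1, abs_of_pos h2]; linarith

/-- An orbit of odd half-period `m` with maximum `u` slightly above `n = N / (q + 1)` would
alternate between values above and below `n`; so `u` is exactly `n`. -/
theorem orbit_max_eq {q N n u : ℤ} {m : ℕ} (hq : 2 ≤ q) (hmo : Odd m) (hn : (q + 1) * n = N)
    (hu0 : 0 < u) (hu : q * u < N) (hu2 : n < q * (N - q * u))
    (r : ℕ → ℤ) (h0 : r 0 = u)
    (hm : r m = -r 0) (hb : ∀ j, |r j| ≤ u) (hs : ∀ j, ∃ k : ℤ, r (j + 1) = q * r j + k * N) :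
    u = n := by
  have step : ∀ j, |r (j + 1)| = q * |r j| ∨ |r (j + 1)| = N - q * |r j| := fun j => by
    obtain ⟨k, hk⟩ := hs j
    exact abs_orbit_step (by linarith) hu (hb j) (hb (j + 1)) hk
  have ha0 : |r 0| = u := by rw [h0, abs_of_pos hu0]
  have hge : n ≤ u := by
    by_contra! hlt
    have h1 := hb 1
    have h2 := step 0
    rw [ha0, zero_add] at h2
    rcases h2 with h2 | h2 <;> nlinarith
  by_contra hne
  have hgt : n < u := lt_of_le_of_ne hge (Ne.symm hne)
  have below : ∀ j, n < |r j| → |r (j + 1)| = N - q * |r j| ∧ |r (j + 1)| < n := by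
    intro j hj
    have h1 : |r (j + 1)| = N - q * |r j| := by
      refine (step j).resolve_left fun h => ?_
      have := hb (j + 1)
      nlinarith
    exact ⟨h1, by nlinarith⟩
  have above : ∀ j, n < |r j| → n < |r (j + 2)| := by
    intro j hj
    obtain ⟨h1, h2⟩ := below j hj
    have h3 := hb j
    rcases step (j + 1) with h | h
    · have h4 : q * |r j| ≤ q * u := by nlinarith
      have h5 : q * (N - q * u) ≤ q * |r (j + 1)| := by
        apply mul_le_mul_of_nonneg_left _ (by linarith); linarith
      show n < |r (j + 1 + 1)|
      linarith
    · show n < |r (j + 1 + 1)|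
      nlinarith
  have even : ∀ t, n < |r (2 * t)| := by
    intro t
    induction t with
    | zero => rw [mul_zero, ha0]; exact hgt
    | succ t ih => exact above _ ih
  obtain ⟨t, rfl⟩ := hmo
  have h1 := (below _ (even t)).2
  rw [hm, abs_neg, ha0] at h1
  linarith

theorem exists_odd_mul_eq_pow_add_one {q : ℤ} (hq : Odd q) (t : ℕ) :
    ∃ w : ℤ, Odd w ∧ (q + 1) * w = q ^ (2 * t + 1) + 1 := by
  induction t with
  | zero => exact ⟨1, odd_one, by ring⟩
  | succ t ih =>
    obtain ⟨w, hw, h⟩ := ih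
    refine ⟨q ^ 2 * w - (q - 1), (hq.pow.mul hw).sub_even (hq.sub_odd odd_one), ?_⟩
    linear_combination q ^ 2 * h

/-- For odd half-period, every later point of the orbit of the second extremal value
`u = (q ^ 2 + q - 1) * w - q + 1` is strictly smaller than `u`. -/
theorem abs_lt_of_odd_orbit {q w z P : ℤ} (hq : 3 ≤ q) (hw : 1 ≤ w) (hP : (q + 1) * w = P + 1)
    (h1 : q * z ≤ P) (h2 : -P ≤ q ^ 2 * z) :
    |(q ^ 2 * w - q + 1) - z * (q - 1) ^ 2| < (q ^ 2 + q - 1) * w - q + 1 := by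
  have hqw : q ≤ q * w := by nlinarith
  have hqqw : 3 * (q * w) ≤ q ^ 2 * w := by nlinarith
  have hq2 : 3 * q ≤ q ^ 2 := by nlinarith
  rw [abs_lt]
  constructor
  · have h3 : q * (q * z) ≤ q * P := mul_le_mul_of_nonneg_left h1 (by linarith)
    have h4 : q * P = q ^ 2 * w + q * w - q := by linear_combination (-q) * hP
    rcases le_or_gt z 0 with hz | hz
    · have : z * (q - 1) ^ 2 ≤ 0 := mul_nonpos_of_nonpos_of_nonneg hz (sq_nonneg _)
      nlinarith
    · have : z * (q - 1) ^ 2 ≤ q * (q * z) := by nlinarith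
      nlinarith
  · have h5 : -z * (q - 1) < w := by
      rcases le_or_gt 0 z with hz | hz
      · nlinarith
      · have h6 : (q + 1) * (-z * (q - 1)) < (q + 1) * w := by nlinarith
        exact lt_of_mul_lt_mul_left h6 (by linarith)
    have h7 : (q - 1) * (-z * (q - 1)) < (q - 1) * w :=
      mul_lt_mul_of_pos_left h5 (by linarith)
    nlinarith

theorem second_leader_of_mod_four_eq_one {q m i : ℕ} (hq : Odd q) (hq3 : 3 ≤ q) (hm : 2 ≤ m)
    (h4 : q ^ m % 4 = 1) (hi : i = (q ^ m - 1) / 2 - q ^ (m - 1)) :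
    Odd i ∧ IsCosetLeader q (q ^ m + 1) i ∧ i < (q ^ m + 1) / 2 ∧
    (∀ l : ℕ, Odd l → IsCosetLeader q (q ^ m + 1) l → l ≠ (q ^ m + 1) / 2 → l ≤ i) ∧
    (cycCoset q (q ^ m + 1) i).ncard = 2 * m := by
  obtain ⟨k, rfl⟩ : ∃ k, m = k + 2 := ⟨m - 2, by omega⟩
  rw [show k + 2 - 1 = k + 1 from rfl] at hi
  have hPo : Odd (q ^ (k + 1)) := hq.pow
  have hP3 : 3 ≤ q ^ (k + 1) := hq3.trans (Nat.le_self_pow (by omega) q)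
  have hqP : q ^ (k + 2) = q * q ^ (k + 1) := by ring
  have h3P : 3 * q ^ (k + 1) ≤ q ^ (k + 2) := by rw [hqP]; exact Nat.mul_le_mul_right _ hq3
  obtain ⟨c, hc⟩ : ∃ c, q ^ (k + 2) + 1 = 2 * c := ⟨(q ^ (k + 2) + 1) / 2, by omega⟩
  have hc2 : (q ^ (k + 2) + 1) / 2 = c := by omega
  have hco : Odd c := by rw [Nat.odd_iff]; omega
  have hcz : (q : ℤ) ^ (k + 2) + 1 = 2 * c := by exact_mod_cast hc
  have hPz : ((q ^ (k + 1) : ℕ) : ℤ) = (q : ℤ) ^ (k + 1) := by push_cast; rfl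
  have hciu : c = i + (q ^ (k + 1) + 1) := by omega
  have hodd : Odd i := by rw [Nat.odd_iff] at hPo hco ⊢; omega
  rw [hc2]
  have main := isCosetLeader_and_ncard hq (by omega) hc hciu (by omega) (by omega) (by
    intro j h0 hj
    obtain ⟨j, rfl⟩ : ∃ a, j = a + 1 := ⟨j - 1, by omega⟩
    refine ⟨(q - 1) * q ^ j, ⟨-q ^ j, ?_⟩, ?_⟩
    · push_cast
      linear_combination (q : ℤ) ^ j * (-hcz)
    · have h1 : q ^ (j + 1) ≤ q ^ (k + 1) := Nat.pow_le_pow_right (by omega) (by omega)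
      have h2 : (q : ℤ) ^ (j + 1) ≤ q ^ (k + 1) := by exact_mod_cast h1
      have h3 : (0 : ℤ) < q ^ j := by positivity
      have h4 : (0 : ℤ) ≤ (q : ℤ) - 1 := by omega
      rw [abs_of_nonneg (by positivity)]
      push_cast
      rw [pow_succ] at h2
      linarith)
  refine ⟨hodd, main.1, by omega, ?_, main.2⟩
  intro l hl hlead hne
  by_contra! hlt
  obtain ⟨hlc, r, hr0, hrm, hrb, hrs⟩ := hlead.exists_orbit hq hc hl.pos
  refine no_small_even_orbit (q := q) (c := c) (u := c - l) (by omega) (by exact_mod_cast hq)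
    (by exact_mod_cast hco) (by omega) ?_ ?_ r hr0 hrm hrb hrs
  · rw [Nat.odd_iff] at hco hl
    rw [Int.even_iff]
    omega
  · have h1 : (c - l : ℤ) ≤ (q : ℤ) ^ (k + 1) := by omega
    have h2 : (q : ℤ) * (c - l) ≤ q * q ^ (k + 1) := mul_le_mul_of_nonneg_left h1 (by omega)
    rw [← hcz]
    have h3 : (q : ℤ) ^ (k + 2) = q * q ^ (k + 1) := by ring
    linarith

theorem second_leader_of_mod_four_eq_three {q m δ i : ℕ} (hq : Odd q) (hq3 : 3 ≤ q)
    (hm : 2 ≤ m) (h4 : q ^ m % 4 = 3) (hδ : δ = (q - 1) * (q ^ m + 1) / (2 * (q + 1)))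
    (hi : i = (q - 1) * (q ^ m - 2 * q ^ (m - 2) - 1) / (2 * (q + 1))) :
    Odd i ∧ IsCosetLeader q (q ^ m + 1) i ∧ i < δ ∧
    (∀ l : ℕ, Odd l → IsCosetLeader q (q ^ m + 1) l → l ≠ δ → l ≤ i) ∧
    (cycCoset q (q ^ m + 1) i).ncard = 2 * m := by
  have hq4 : q % 4 = 3 := by
    by_contra hne
    have h1 : q % 4 = 1 := by rw [Nat.odd_iff] at hq; omega
    rw [Nat.pow_mod, h1, one_pow] at h4
    omega
  have hmo : Odd m := by
    by_contra hne
    rw [Nat.not_odd_iff_even] at hne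
    obtain ⟨a, rfl⟩ := hne
    rw [← two_mul, pow_mul, Nat.pow_mod, Nat.pow_mod q, hq4] at h4
    norm_num at h4
  obtain ⟨t, rfl⟩ : ∃ t, m = 2 * t + 3 := by
    obtain ⟨a, ha⟩ := hmo
    exact ⟨a - 1, by omega⟩
  rw [show 2 * t + 3 - 2 = 2 * t + 1 from rfl] at hi
  obtain ⟨s, rfl⟩ : ∃ s, q = 4 * s + 3 := ⟨q / 4, by omega⟩
  obtain ⟨w, hwo, hw⟩ := exists_odd_mul_eq_pow_add_one (q := ((4 * s + 3 : ℕ) : ℤ))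
    (by exact_mod_cast hq) t
  set q := 4 * s + 3 with hqs
  have hqz : (q : ℤ) = 4 * s + 3 := by rw [hqs]; push_cast; rfl
  have hq3z : (3 : ℤ) ≤ q := by exact_mod_cast hq3
  have hP0 : (0 : ℤ) < (q : ℤ) ^ (2 * t + 1) := by positivity
  have hw1 : 1 ≤ w := by
    by_contra! h
    nlinarith
  have hPm : (q : ℤ) ^ (2 * t + 3) = q ^ 2 * q ^ (2 * t + 1) := by ring
  have hqw : (q : ℤ) ≤ q * w := le_mul_of_one_le_right (by linarith) hw1
  have hwq : 3 * w ≤ q * w := mul_le_mul_of_nonneg_right hq3z (by linarith)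
  have hqqw : 3 * (q * w) ≤ (q : ℤ) ^ 2 * w := by
    have := mul_le_mul_of_nonneg_right hq3z (by linarith : 0 ≤ q * w)
    linarith
  obtain ⟨n, hn⟩ : ∃ n : ℕ, (n : ℤ) = q ^ 2 * w - q + 1 := ⟨_, Int.toNat_of_nonneg (by linarith)⟩
  obtain ⟨d, hd⟩ : ∃ d : ℕ, (d : ℤ) = (q ^ 2 - 2) * w - q + 1 :=
    ⟨_, Int.toNat_of_nonneg (by linarith)⟩
  obtain ⟨u, hu⟩ : ∃ u : ℕ, (u : ℤ) = (q ^ 2 + q - 1) * w - q + 1 :=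
    ⟨_, Int.toNat_of_nonneg (by linarith)⟩
  have hNn : q ^ (2 * t + 3) + 1 = (q + 1) * n := by
    zify
    rw [hn]
    linear_combination hPm - (q : ℤ) ^ 2 * hw
  have hNd : q ^ (2 * t + 3) = (q + 1) * d + 2 * q ^ (2 * t + 1) + 1 := by
    zify
    rw [hd]
    linear_combination hPm - ((q : ℤ) ^ 2 - 2) * hw
  have hδn : δ = (2 * s + 1) * n := by
    rw [hδ, hNn, show q - 1 = 2 * (2 * s + 1) by omega]
    exact Nat.div_eq_of_eq_mul_right (by positivity) (by ring)
  have hid : i = (2 * s + 1) * d := by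
    rw [hi, show q ^ (2 * t + 3) - 2 * q ^ (2 * t + 1) - 1 = (q + 1) * d by omega,
      show q - 1 = 2 * (2 * s + 1) by omega]
    exact Nat.div_eq_of_eq_mul_right (by positivity) (by ring)
  have hqo : Odd (q : ℤ) := by exact_mod_cast hq
  have hdo : Odd d := by
    have : Odd (d : ℤ) := by
      rw [hd, sub_add]
      exact ((hqo.pow.sub_even even_two).mul hwo).sub_even (hqo.sub_odd odd_one)
    exact_mod_cast this
  have hdn : d < n := by
    zify
    rw [hn, hd]
    linarith
  have hc : q ^ (2 * t + 3) + 1 = 2 * (2 * (s + 1) * n) := by rw [hNn, hqs]; ring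
  have hciu : 2 * (s + 1) * n = i + u := by
    rw [hid]
    zify
    rw [hn, hd, hu]
    rw [hqz]
    ring
  have hδc : 2 * (s + 1) * n = δ + n := by rw [hδn]; ring
  have hi0 : 0 < i := by rw [hid]; exact Nat.mul_pos (by omega) hdo.pos
  have hu0 : 0 < u := by
    zify
    rw [hu]
    linarith
  have hiδ : i < δ := by rw [hid, hδn]; exact Nat.mul_lt_mul_of_pos_left hdn (by omega)
  generalize hcc : 2 * (s + 1) * n = c at hc hciu hδc
  have hcn : (2 * c : ℤ) = (q + 1) * n := by
    rw [hNn] at hc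
    exact_mod_cast hc.symm
  have main := isCosetLeader_and_ncard hq (by omega) hc hciu hi0 hu0 (by
    intro j h0 hj
    suffices h : ∃ r : ℤ, (2 * c : ℤ) ∣ r - u * (-(q : ℤ)) ^ j ∧ |r| < u by
      obtain ⟨r, hr, hlt⟩ := h
      rcases Nat.even_or_odd j with hj | hj
      · rw [hj.neg_pow] at hr
        exact ⟨r, hr, hlt⟩
      · rw [hj.neg_pow] at hr
        refine ⟨-r, ?_, by rwa [abs_neg]⟩
        obtain ⟨k, hk⟩ := hr
        exact ⟨-k, by linear_combination -hk⟩
    rcases Nat.lt_or_ge j 2 with h2 | h2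
    · obtain rfl : j = 1 := by omega
      refine ⟨q * w - q + 1, ⟨1, ?_⟩, ?_⟩
      · rw [hcn, hn, hu]
        ring
      · rw [hu, abs_of_pos (by linarith)]
        linarith
    · obtain ⟨j, rfl⟩ : ∃ a, j = a + 2 := ⟨j - 2, by omega⟩
      obtain ⟨e, he⟩ := sub_one_dvd_pow_sub_one (-(q : ℤ)) j
      refine ⟨-((q ^ 2 * w - q + 1) - (-(q : ℤ)) ^ j * (q - 1) ^ 2),
        ⟨-e - q * (-(q : ℤ)) ^ j, ?_⟩, ?_⟩
      · rw [hcn, ← hn]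
        linear_combination (n : ℤ) * he - (q : ℤ) ^ 2 * (-(q : ℤ)) ^ j * hu
          - (1 - q - q ^ 2) * (-(q : ℤ)) ^ j * hn
      · rw [abs_neg, hu]
        have hpow : ∀ a, a ≤ 2 * t + 1 → (q : ℤ) ^ a ≤ q ^ (2 * t + 1) := fun a ha =>
          pow_le_pow_right₀ (by linarith) ha
        apply abs_lt_of_odd_orbit hq3z hw1 hw
        · rcases Nat.even_or_odd j with hj' | hj'
          · rw [hj'.neg_pow, ← pow_succ']
            exact hpow _ (by omega)
          · rw [hj'.neg_pow]
            have : (0 : ℤ) ≤ q * q ^ j := by positivity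
            linarith
        · rcases Nat.even_or_odd j with hj' | hj'
          · rw [hj'.neg_pow]
            have : (0 : ℤ) ≤ q ^ 2 * q ^ j := by positivity
            linarith
          · rw [hj'.neg_pow, mul_neg, ← pow_add, neg_le_neg_iff]
            obtain ⟨a, rfl⟩ := hj'
            exact hpow _ (by omega))
  refine ⟨?_, main.1, hiδ, ?_, main.2⟩
  · rw [hid]
    exact Odd.mul ⟨s, rfl⟩ hdo
  intro l hl hlead hne
  by_contra! hlt
  obtain ⟨hlc, r, hr0, hrm, hrb, hrs⟩ := hlead.exists_orbit hq hc hl.pos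
  have hlu : (c - l : ℤ) ≤ u - 1 := by omega
  have hqlu : (q : ℤ) * (c - l) ≤ q * (u - 1) := mul_le_mul_of_nonneg_left hlu (by linarith)
  have hqu : (q : ℤ) ^ 2 * u = q * (2 * c) - n + (q - 1) ^ 2 := by
    rw [hcn, hu, hn]
    ring
  have hlc' : (0 : ℤ) < c - l := by
    obtain ⟨a, ha⟩ := hl
    rw [mul_assoc] at hcc
    omega
  have hcl : (c - l : ℤ) = n := by
    refine orbit_max_eq (m := 2 * t + 3) (N := 2 * c) (by linarith) hmo hcn.symm hlc' ?_ ?_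
      r hr0 hrm hrb hrs
    · refine lt_of_mul_lt_mul_left ?_ (by linarith : (0 : ℤ) ≤ q)
      have := mul_le_mul_of_nonneg_left hqlu (by linarith : (0 : ℤ) ≤ q)
      have : (0 : ℤ) ≤ n := by omega
      linarith
    · have := mul_le_mul_of_nonneg_left hqlu (by linarith : (0 : ℤ) ≤ q)
      linarith
  omega

theorem stmt14 (q m : ℕ) (hq : Odd q) (hpp : IsPrimePow q) (hm : 2 ≤ m)
    (δ1 δ2 : ℕ)
    (hδ1a : q ^ m % 4 = 1 → δ1 = (q ^ m + 1) / 2)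
    (hδ1b : q ^ m % 4 = 3 → δ1 = (q - 1) * (q ^ m + 1) / (2 * (q + 1)))
    (hδ2a : q ^ m % 4 = 1 → δ2 = (q ^ m - 1) / 2 - q ^ (m - 1))
    (hδ2b : q ^ m % 4 = 3 →
      δ2 = (q - 1) * (q ^ m - 2 * q ^ (m - 2) - 1) / (2 * (q + 1))) :
    Odd δ2 ∧
    IsCosetLeader q (q ^ m + 1) δ2 ∧
    δ2 < δ1 ∧
    (∀ i : ℕ, Odd i → IsCosetLeader q (q ^ m + 1) i → i ≠ δ1 → i ≤ δ2) ∧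
    (cycCoset q (q ^ m + 1) δ2).ncard = 2 * m := by
  have hq3 : 3 ≤ q := by
    have h1 := hpp.one_lt
    rw [Nat.odd_iff] at hq
    omega
  have hqm : Odd (q ^ m) := hq.pow
  have h4 : q ^ m % 4 = 1 ∨ q ^ m % 4 = 3 := by rw [Nat.odd_iff] at hqm; omega
  rcases h4 with h4 | h4
  · obtain rfl := hδ1a h4
    exact second_leader_of_mod_four_eq_one hq hq3 hm h4 (hδ2a h4)
  · exact second_leader_of_mod_four_eq_three hq hq3 hm h4 (hδ1b h4) (hδ2b h4)
end
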